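/- arXiv:2603.04903 — 2 statements merged into one kernel-verified Lean document; each statement's English description precedes it below -/
import Mathlib

section
/- Let n ≥ 1, ε > 0, and let Δ = {z ∈ ℂⁿ : |z_k| < ε for all k} be the open polydisc. Then for every holomorphic function f on Δ \ {z₁ = 0}, every compact set K ⊆ Δ \ {z₁ = 0}, and every δ > 0, there exist N ∈ ℕ and an entire function g : ℂⁿ → ℂ such that |f(z) − g(z)/z₁^N| < δ for all z ∈ K. In particular Δ \ {z₁ = 0} is Runge in ℂⁿ \ {z₁ = 0}. -/
/-- An open (or arbitrary) set `Ω ⊆ U` in `ℂⁿ` is Runge in `U` if every holomorphic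
function on `Ω` can be approximated uniformly on every compact subset of `Ω` by
functions holomorphic on `U`. -/
def RungeIn (n : ℕ) (Ω U : Set (Fin n → ℂ)) : Prop :=
  ∀ f : (Fin n → ℂ) → ℂ, DifferentiableOn ℂ f Ω →
    ∀ K : Set (Fin n → ℂ), K ⊆ Ω → IsCompact K →
      ∀ δ : ℝ, 0 < δ →
        ∃ g : (Fin n → ℂ) → ℂ, DifferentiableOn ℂ g U ∧ ∀ z ∈ K, ‖f z - g z‖ < δ

open Metric Set Function

section ParametricIntegrals

variable {E : Type*} [NormedAddCommGroup E] [NormedSpace ℂ E] [ProperSpace E]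

/-- An integral over a compact interval of a jointly continuous function which is holomorphic in
the parameter is holomorphic in the parameter. -/
lemma differentiableOn_intervalIntegral_of_continuousOn {G : E → ℝ → ℂ} {U : Set E} {a b : ℝ}
    (hab : a ≤ b) (hU : IsOpen U) (hc : ContinuousOn (uncurry G) (U ×ˢ Icc a b))
    (hd : ∀ t ∈ Icc a b, DifferentiableOn ℂ (G · t) U) :
    DifferentiableOn ℂ (fun z ↦ ∫ t in a..b, G z t) U := by
  intro x₀ hx₀
  obtain ⟨r, hr, hrU⟩ := nhds_basis_closedBall.mem_iff.1 (hU.mem_nhds hx₀)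
  have hbU : ball x₀ r ⊆ U := ball_subset_closedBall.trans hrU
  have huc : UniformContinuousOn (uncurry G) (closedBall x₀ r ×ˢ Icc a b) :=
    ((isCompact_closedBall x₀ r).prod isCompact_Icc).uniformContinuousOn_of_continuous
      (hc.mono (prod_mono hrU Subset.rfl))
  rw [Metric.uniformContinuousOn_iff] at huc
  have hct : ∀ z ∈ U, ContinuousOn (G z) (Icc a b) := fun z hz ↦
    hc.comp (continuousOn_const.prodMk continuousOn_id) fun t ht ↦ ⟨hz, ht⟩
  have hda : ∀ t ∈ Icc a b, DifferentiableAt ℂ (G · t) x₀ := fun t ht ↦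
    (hd t ht).differentiableAt (hU.mem_nhds hx₀)
  have hF'c : ContinuousOn (fun t ↦ fderiv ℂ (G · t) x₀) (Icc a b) := by
    rw [Metric.continuousOn_iff]
    intro t ht e he
    obtain ⟨δ, hδ, H⟩ := huc (e * r / 4) (by positivity)
    refine ⟨δ, hδ, fun s hs hst ↦ ?_⟩
    have hle : ∀ z ∈ ball x₀ r, ‖G z s - G z t‖ ≤ e * r / 4 := fun z hz ↦ by
      have := H (z, s) ⟨ball_subset_closedBall hz, hs⟩ (z, t) ⟨ball_subset_closedBall hz, ht⟩
        (by simpa [Prod.dist_eq, hδ] using hst)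
      simpa [uncurry, dist_eq_norm] using this.le
    have hfd := Complex.norm_fderiv_le_div_of_mapsTo_ball (f := fun z ↦ G z s - G z t)
      (c := x₀) (R₁ := r) (R₂ := e * r / 2)
      (((hd s hs).sub (hd t ht)).mono hbU) (fun z hz ↦ by
        rw [mem_closedBall, dist_eq_norm]
        refine (norm_sub_le _ _).trans ?_
        linarith [hle z hz, hle x₀ (mem_ball_self hr)]) hr
    rw [dist_eq_norm, ← fderiv_fun_sub (hda s hs) (hda t ht)]
    refine hfd.trans_lt ?_
    rw [mul_div_right_comm, mul_div_assoc, div_self hr.ne']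
    linarith
  obtain ⟨δ, hδ, H⟩ := huc 1 one_pos
  set ρ := min δ r
  have hρ0 : 0 < ρ := lt_min hδ hr
  have hρU : ball x₀ ρ ⊆ U := (ball_subset_ball (min_le_right _ _)).trans hbU
  have hmeas : ∀ z ∈ U, MeasureTheory.AEStronglyMeasurable (G z)
      (MeasureTheory.volume.restrict (Ioc a b)) := fun z hz ↦
    ((hct z hz).mono Ioc_subset_Icc_self).aestronglyMeasurable measurableSet_Ioc
  have key := hasFDerivAt_integral_of_dominated_loc_of_lip' (𝕜 := ℂ) (F := G) (x₀ := x₀)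
    (F' := fun t ↦ fderiv ℂ (G · t) x₀) (bound := fun _ ↦ 1 / ρ)
    (μ := MeasureTheory.volume.restrict (Ioc a b)) (ball_mem_nhds x₀ hρ0)
    (fun z hz ↦ hmeas z (hρU hz))
    ((hct x₀ hx₀).integrableOn_Icc.mono_set Ioc_subset_Icc_self)
    ((hF'c.mono Ioc_subset_Icc_self).aestronglyMeasurable measurableSet_Ioc)
    (by
      filter_upwards [MeasureTheory.ae_restrict_mem measurableSet_Ioc] with t ht z hz
      have ht' := Ioc_subset_Icc_self ht
      have := Complex.dist_le_div_mul_dist_of_mapsTo_ball (f := (G · t)) (c := x₀) (R₁ := ρ)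
        (R₂ := 1) ((hd t ht').mono hρU) (fun y hy ↦ by
          have hy' := ball_subset_ball (min_le_right δ r) hy
          have := H (y, t) ⟨ball_subset_closedBall hy', ht'⟩
            (x₀, t) ⟨mem_closedBall_self hr.le, ht'⟩
            (by simpa [Prod.dist_eq, hδ] using (mem_ball.1 hy).trans_le (min_le_left _ _))
          exact this.le) hz
      simpa [dist_eq_norm] using this)
    (MeasureTheory.integrable_const _)
    (by
      filter_upwards [MeasureTheory.ae_restrict_mem measurableSet_Ioc] with t ht
      exact (hda t (Ioc_subset_Icc_self ht)).hasFDerivAt)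
  simp only [intervalIntegral.integral_of_le hab]
  exact key.2.differentiableAt.differentiableWithinAt

lemma differentiableOn_circleIntegral_of_continuousOn {h : E → ℂ → ℂ} {U : Set E} {R : ℝ}
    (hR : 0 ≤ R) (hU : IsOpen U) (hc : ContinuousOn (uncurry h) (U ×ˢ sphere 0 R))
    (hd : ∀ ζ ∈ sphere (0 : ℂ) R, DifferentiableOn ℂ (h · ζ) U) :
    DifferentiableOn ℂ (fun z ↦ ∮ ζ in C(0, R), h z ζ) U := by
  refine differentiableOn_intervalIntegral_of_continuousOn Real.two_pi_pos.le hU ?_ ?_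
  · refine ContinuousOn.smul (f := fun p : E × ℝ ↦ deriv (circleMap 0 R) p.2)
      (g := fun p : E × ℝ ↦ h p.1 (circleMap 0 R p.2)) ?_ ?_
    · simp only [deriv_circleMap]
      fun_prop
    · refine hc.comp (f := fun p : E × ℝ ↦ (p.1, circleMap 0 R p.2)) ?_ ?_
      · fun_prop
      · exact fun p hp ↦ ⟨hp.1, circleMap_mem_sphere _ hR _⟩
  · intro t _
    exact (hd _ (circleMap_mem_sphere 0 hR t)).const_smul (deriv (circleMap 0 R) t)

end ParametricIntegrals

section CauchyKernel

/-- The polynomial `∑ i < M, ζ ^ i * w ^ (M - 1 - i)`, whose product with `ζ - w` is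
`ζ ^ M - w ^ M`. -/
noncomputable def geomKernel (M : ℕ) (w ζ : ℂ) : ℂ :=
  ∑ i ∈ Finset.range M, ζ ^ i * w ^ (M - 1 - i)

lemma geomKernel_mul_sub (M : ℕ) (w ζ : ℂ) :
    geomKernel M w ζ * (ζ - w) = ζ ^ M - w ^ M :=
  (Commute.all ζ w).geom_sum₂_mul M

lemma geomKernel_comm (M : ℕ) (w ζ : ℂ) : geomKernel M w ζ = geomKernel M ζ w :=
  (Commute.all ζ w).geom_sum₂_comm M

lemma continuous_geomKernel (M : ℕ) : Continuous (uncurry (geomKernel M)) := by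
  unfold geomKernel uncurry
  fun_prop

lemma differentiable_geomKernel (M : ℕ) (ζ : ℂ) : Differentiable ℂ (geomKernel M · ζ) := by
  unfold geomKernel
  fun_prop

lemma norm_inv_sub_sub_inv_pow_mul_geomKernel_le {M : ℕ} {w ζ : ℂ} {ρ R : ℝ} (hρ : ρ < R)
    (hw : ‖w‖ ≤ ρ) (hζ : R ≤ ‖ζ‖) :
    ‖(ζ - w)⁻¹ - (ζ ^ M)⁻¹ * geomKernel M w ζ‖ ≤ (ρ / R) ^ M / (R - ρ) := by
  have hR : 0 < R := ((norm_nonneg w).trans hw).trans_lt hρ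
  have hζ0 : ζ ≠ 0 := norm_pos_iff.1 (hR.trans_le hζ)
  have hsub : R - ρ ≤ ‖ζ - w‖ := by linarith [norm_sub_norm_le ζ w]
  have hne : ζ - w ≠ 0 := norm_pos_iff.1 (by linarith)
  have h : (ζ - w)⁻¹ - (ζ ^ M)⁻¹ * geomKernel M w ζ = (w / ζ) ^ M / (ζ - w) := by
    rw [eq_div_iff hne, sub_mul, mul_assoc, geomKernel_mul_sub, inv_mul_cancel₀ hne, mul_sub,
      inv_mul_cancel₀ (pow_ne_zero _ hζ0), div_pow]
    ring
  have hρR : 0 < R - ρ := by linarith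
  have hρ0 : 0 ≤ ρ := (norm_nonneg w).trans hw
  rw [h, norm_div, norm_pow, norm_div]
  gcongr

/-- The **Cauchy integral formula** for an annulus. -/
lemma circleIntegral_div_sub_sub_circleIntegral_div_sub {φ : ℂ → ℂ} {V : Set ℂ} {r R : ℝ} {w : ℂ}
    (hr : 0 < r) (hrw : r < ‖w‖) (hwR : ‖w‖ < R) (hV : IsOpen V)
    (hsub : closedBall 0 R \ ball 0 r ⊆ V) (hφ : DifferentiableOn ℂ φ V) :
    (∮ ζ in C(0, R), φ ζ * (ζ - w)⁻¹) - (∮ ζ in C(0, r), φ ζ * (ζ - w)⁻¹) =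
      2 * Real.pi * Complex.I * φ w := by
  have hrR := hrw.trans hwR
  have hwV : V ∈ nhds w := hV.mem_nhds (hsub ⟨by simpa using hwR.le, by simpa using hrw.le⟩)
  have hds := Complex.circleIntegral_eq_of_differentiable_on_annulus_off_countable hr hrR.le
    (f := dslope φ w) (c := 0) (countable_singleton w)
    (((continuousOn_dslope hwV).2 ⟨hφ.continuousOn, hφ.differentiableAt hwV⟩).mono hsub)
    (fun z hz ↦ (differentiableAt_dslope_of_ne hz.2).2 (hφ.differentiableAt (hV.mem_nhds
      (hsub ⟨ball_subset_closedBall hz.1.1, fun h ↦ hz.1.2 (ball_subset_closedBall h)⟩))))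
  have hsplit : ∀ s : ℝ, 0 < s → s ≠ ‖w‖ → sphere 0 s ⊆ V →
      (∮ ζ in C(0, s), dslope φ w ζ) =
        (∮ ζ in C(0, s), φ ζ * (ζ - w)⁻¹) - φ w * ∮ ζ in C(0, s), (ζ - w)⁻¹ := by
    intro s hs hsw hsV
    have hne : ∀ ζ ∈ sphere (0 : ℂ) s, ζ - w ≠ 0 := by
      intro ζ hζ h
      rw [sub_eq_zero] at h
      exact hsw (by simpa [h] using hζ.symm)
    have hinv : ContinuousOn (fun ζ ↦ (ζ - w)⁻¹) (sphere (0 : ℂ) s) :=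
      (by fun_prop : ContinuousOn (fun ζ ↦ ζ - w) (sphere (0 : ℂ) s)).inv₀ hne
    rw [← circleIntegral.integral_const_mul, ← circleIntegral.integral_sub
      (((hφ.continuousOn.mono hsV).fun_mul hinv).circleIntegrable hs.le)
      ((continuousOn_const.fun_mul hinv).circleIntegrable hs.le)]
    refine circleIntegral.integral_congr hs.le fun ζ hζ ↦ ?_
    rw [dslope_of_ne _ (sub_ne_zero.1 (hne ζ hζ)), slope_def_field]
    ring
  have hout : (∮ ζ in C(0, R), (ζ - w)⁻¹) = 2 * Real.pi * Complex.I :=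
    circleIntegral.integral_sub_inv_of_mem_ball (by simpa using hwR)
  have hin : (∮ ζ in C(0, r), (ζ - w)⁻¹) = 0 := by
    refine Complex.circleIntegral_eq_zero_of_differentiable_on_off_countable hr.le
      countable_empty (fun z hz ↦ ?_) (fun z hz ↦ ?_)
    all_goals
      have hz' : z - w ≠ 0 := by
        rintro h
        rw [sub_eq_zero] at h
        subst h
        simp at hz
        linarith
    · exact ((continuousAt_id.sub continuousAt_const).inv₀ hz').continuousWithinAt
    · exact (differentiableAt_id.sub_const w).inv hz'
  rw [hsplit R (by linarith) hwR.ne' fun z hz ↦ hsub ⟨sphere_subset_closedBall hz, by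
      simp only [mem_sphere_iff_norm, sub_zero] at hz; simp [hz, hrR.le]⟩,
    hsplit r hr hrw.ne fun z hz ↦ hsub ⟨by
      simp only [mem_sphere_iff_norm, sub_zero] at hz; simp [hz, hrR.le], by
      simp only [mem_sphere_iff_norm, sub_zero] at hz; simp [hz]⟩, hout, hin] at hds
  linear_combination hds

lemma norm_circleIntegral_mul_sub_circleIntegral_mul_le {φ κ₁ κ₂ : ℂ → ℂ} {R C e : ℝ} (hR : 0 ≤ R)
    (hC : 0 ≤ C)
    (hφ : ContinuousOn φ (sphere 0 R)) (h₁ : ContinuousOn κ₁ (sphere 0 R))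
    (h₂ : ContinuousOn κ₂ (sphere 0 R)) (hφC : ∀ ζ ∈ sphere 0 R, ‖φ ζ‖ ≤ C)
    (he : ∀ ζ ∈ sphere 0 R, ‖κ₁ ζ - κ₂ ζ‖ ≤ e) :
    ‖(∮ ζ in C(0, R), φ ζ * κ₁ ζ) - ∮ ζ in C(0, R), φ ζ * κ₂ ζ‖ ≤
      2 * Real.pi * R * (C * e) := by
  rw [← circleIntegral.integral_sub ((hφ.fun_mul h₁).circleIntegrable hR)
    ((hφ.fun_mul h₂).circleIntegrable hR)]
  refine circleIntegral.norm_integral_le_of_norm_le_const hR fun ζ hζ ↦ ?_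
  rw [← mul_sub, norm_mul]
  exact mul_le_mul (hφC ζ hζ) (he ζ hζ) (norm_nonneg _) hC

end CauchyKernel

section Polydisc

open Filter Topology

variable {n : ℕ} {D D' K : Set (Fin n → ℂ)} {f : (Fin n → ℂ) → ℂ} {j : Fin n} {ε R : ℝ}

lemma differentiableOn_circleIntegral_update {κ : ℂ → ℂ → ℂ} (hR : 0 ≤ R) (hD : IsOpen D)
    (hf : DifferentiableOn ℂ f D')
    (hmaps : ∀ z ∈ D, ∀ ζ ∈ sphere (0 : ℂ) R, update z j ζ ∈ D')
    (hκ : ContinuousOn (uncurry κ) (univ ×ˢ sphere 0 R))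
    (hκd : ∀ ζ ∈ sphere (0 : ℂ) R, Differentiable ℂ (κ · ζ)) :
    DifferentiableOn ℂ (fun z ↦ ∮ ζ in C(0, R), f (update z j ζ) * κ (z j) ζ) D := by
  refine differentiableOn_circleIntegral_of_continuousOn hR hD ?_ fun ζ hζ ↦ ?_
  · refine ContinuousOn.mul
      (f := fun p : (Fin n → ℂ) × ℂ ↦ f (update p.1 j p.2))
      (g := fun p : (Fin n → ℂ) × ℂ ↦ κ (p.1 j) p.2) ?_ ?_
    · exact hf.continuousOn.comp (continuous_fst.update j continuous_snd).continuousOn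
        fun p hp ↦ hmaps _ hp.1 _ hp.2
    · exact hκ.comp (f := fun p : (Fin n → ℂ) × ℂ ↦ (p.1 j, p.2)) (by fun_prop)
        fun p hp ↦ ⟨mem_univ _, hp.2⟩
  · have hupd : Differentiable ℂ fun z : Fin n → ℂ ↦ update z j ζ := by
      refine differentiable_pi.2 fun k ↦ ?_
      rcases eq_or_ne k j with rfl | hk
      · simp
      · simpa [hk] using differentiable_apply k
    exact (hf.comp hupd.differentiableOn fun z hz ↦ hmaps z hz ζ hζ).mul
      ((hκd ζ hζ).comp (differentiable_apply j)).differentiableOn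

lemma eventually_norm_circleIntegral_update_sub_lt {κ : ℂ → ℂ → ℂ} {κ' : ℕ → ℂ → ℂ → ℂ} {e : ℕ → ℝ}
    (hR : 0 ≤ R) (hf : ContinuousOn f D) (hK : IsCompact K)
    (hmaps : ∀ z ∈ K, ∀ ζ ∈ sphere (0 : ℂ) R, update z j ζ ∈ D)
    (hκ : ∀ z ∈ K, ContinuousOn (κ (z j)) (sphere 0 R))
    (hκ' : ∀ M, ∀ z ∈ K, ContinuousOn (κ' M (z j)) (sphere 0 R))
    (he : Tendsto e atTop (𝓝 0))
    (hle : ∀ M, ∀ z ∈ K, ∀ ζ ∈ sphere (0 : ℂ) R, ‖κ (z j) ζ - κ' M (z j) ζ‖ ≤ e M)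
    {δ : ℝ} (hδ : 0 < δ) :
    ∀ᶠ M in atTop, ∀ z ∈ K, ‖(∮ ζ in C(0, R), f (update z j ζ) * κ (z j) ζ) -
      ∮ ζ in C(0, R), f (update z j ζ) * κ' M (z j) ζ‖ < δ := by
  have hc : ContinuousOn (fun p : (Fin n → ℂ) × ℂ ↦ f (update p.1 j p.2)) (K ×ˢ sphere 0 R) :=
    hf.comp (continuous_fst.update j continuous_snd).continuousOn fun p hp ↦ hmaps _ hp.1 _ hp.2
  obtain ⟨C, hC⟩ := (hK.prod (isCompact_sphere 0 R)).exists_bound_of_continuousOn hc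
  have hlim : Tendsto (fun M ↦ 2 * Real.pi * R * (max C 0 * e M)) atTop (𝓝 0) := by
    simpa using (he.const_mul (max C 0)).const_mul (2 * Real.pi * R)
  filter_upwards [hlim.eventually_lt_const hδ] with M hM z hz
  refine (norm_circleIntegral_mul_sub_circleIntegral_mul_le hR (le_max_right C 0) ?_ (hκ z hz)
    (hκ' M z hz) (fun ζ hζ ↦ (hC (z, ζ) ⟨hz, hζ⟩).trans (le_max_left _ _)) (hle M z hz)).trans_lt hM
  exact hc.comp (f := fun ζ ↦ (z, ζ)) (by fun_prop) fun ζ hζ ↦ ⟨hz, hζ⟩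

lemma tendsto_div_pow_div_atTop_nhds_zero {ρ c : ℝ} (hρ : 0 ≤ ρ) (h : ρ < R) :
    Tendsto (fun M : ℕ ↦ (ρ / R) ^ M / c) atTop (𝓝 0) := by
  simpa using (tendsto_pow_atTop_nhds_zero_of_lt_one (div_nonneg hρ (hρ.trans h.le))
    ((div_lt_one (hρ.trans_lt h)).2 h)).div_const c

lemma continuousOn_inv_sub_sphere {w : ℂ} (hw : ‖w‖ ≠ R) :
    ContinuousOn (fun ζ ↦ (ζ - w)⁻¹) (sphere 0 R) := by
  refine (by fun_prop : ContinuousOn (fun ζ ↦ ζ - w) (sphere (0 : ℂ) R)).inv₀ fun ζ hζ h ↦ hw ?_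
  rw [sub_eq_zero] at h
  simpa [h] using hζ

lemma continuousOn_inv_pow_mul_geomKernel (hR : 0 < R) (M : ℕ) :
    ContinuousOn (uncurry fun w ζ : ℂ ↦ (ζ ^ M)⁻¹ * geomKernel M w ζ) (univ ×ˢ sphere 0 R) := by
  refine ContinuousOn.mul (f := fun p : ℂ × ℂ ↦ (p.2 ^ M)⁻¹) ?_
    (continuous_geomKernel M).continuousOn
  refine (by fun_prop : Continuous fun p : ℂ × ℂ ↦ p.2 ^ M).continuousOn.inv₀ fun p hp ↦ ?_
  exact pow_ne_zero _ (norm_pos_iff.1 (by rwa [mem_sphere_zero_iff_norm.1 hp.2]))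

lemma differentiable_update (z : Fin n → ℂ) (j : Fin n) :
    Differentiable ℂ (update z j) := by
  refine differentiable_pi.2 fun k ↦ ?_
  rcases eq_or_ne k j with rfl | hk
  · simp
  · simp [hk]

lemma isOpen_setOf_forall_mem_norm_lt (S : Finset (Fin n)) (ε : ℝ) :
    IsOpen {z : Fin n → ℂ | ∀ k ∈ S, ‖z k‖ < ε} := by
  have : {z : Fin n → ℂ | ∀ k ∈ S, ‖z k‖ < ε} = ⋂ k ∈ S, {z | ‖z k‖ < ε} := by
    ext; simp
  rw [this]
  exact isOpen_biInter_finset fun k _ ↦ isOpen_lt (continuous_apply k).norm continuous_const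

lemma update_mem_setOf_forall_mem_norm_lt {S : Finset (Fin n)} {z : Fin n → ℂ} {ζ : ℂ}
    (hz : ∀ k ∈ S, ‖z k‖ < ε) (hζ : ‖ζ‖ < ε) :
    ∀ k ∈ insert j S, ‖update z j ζ k‖ < ε := by
  intro k hk
  rcases eq_or_ne k j with rfl | hkj
  · simpa using hζ
  · simpa [hkj] using hz k ((Finset.mem_insert.1 hk).resolve_left hkj)

/-- A function holomorphic on a product of discs and planes can be approximated on compact sets by
functions which are moreover entire in the `j`-th coordinate. -/
lemma exists_differentiableOn_norm_sub_lt_of_insert {S : Finset (Fin n)}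
    (hf : DifferentiableOn ℂ f {z | ∀ k ∈ insert j S, ‖z k‖ < ε})
    (hK : IsCompact K) (hKD : K ⊆ {z | ∀ k ∈ insert j S, ‖z k‖ < ε}) {δ : ℝ} (hδ : 0 < δ) :
    ∃ g : (Fin n → ℂ) → ℂ, DifferentiableOn ℂ g {z | ∀ k ∈ S, ‖z k‖ < ε} ∧
      ∀ z ∈ K, ‖f z - g z‖ < δ := by
  rcases K.eq_empty_or_nonempty with rfl | hne
  · exact ⟨0, differentiableOn_const 0, by simp⟩
  obtain ⟨z₁, hz₁, hmax⟩ := hK.exists_isMaxOn hne (continuous_apply j).norm.continuousOn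
  set ρ := ‖z₁ j‖
  have hρ0 : 0 ≤ ρ := norm_nonneg _
  obtain ⟨R, hρR, hRε⟩ := exists_between (hKD hz₁ j (Finset.mem_insert_self j S))
  have hR : 0 < R := hρ0.trans_lt hρR
  have hKρ : ∀ z ∈ K, ‖z j‖ ≤ ρ := fun z hz ↦ hmax hz
  have hmaps : ∀ z ∈ {z : Fin n → ℂ | ∀ k ∈ S, ‖z k‖ < ε}, ∀ ζ ∈ closedBall (0 : ℂ) R,
      update z j ζ ∈ {z | ∀ k ∈ insert j S, ‖z k‖ < ε} := fun z hz ζ hζ ↦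
    update_mem_setOf_forall_mem_norm_lt hz ((mem_closedBall_zero_iff.1 hζ).trans_lt hRε)
  have hKS : ∀ z ∈ K, z ∈ {z : Fin n → ℂ | ∀ k ∈ S, ‖z k‖ < ε} := fun z hz k hk ↦
    hKD hz k (Finset.mem_insert_of_mem hk)
  have hpi : (2 * Real.pi * Complex.I : ℂ) ≠ 0 := Complex.two_pi_I_ne_zero
  have hpi' : 0 < ‖(2 * Real.pi * Complex.I : ℂ)‖ := norm_pos_iff.2 hpi
  obtain ⟨M, hM⟩ := (eventually_norm_circleIntegral_update_sub_lt (j := j)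
    (κ := fun w ζ ↦ (ζ - w)⁻¹) (κ' := fun M w ζ ↦ (ζ ^ M)⁻¹ * geomKernel M w ζ) hR.le
    hf.continuousOn hK (fun z hz ζ hζ ↦ hmaps z (hKS z hz) ζ (sphere_subset_closedBall hζ))
    (fun z hz ↦ continuousOn_inv_sub_sphere ((hKρ z hz).trans_lt hρR).ne)
    (fun M z _ ↦ (continuousOn_inv_pow_mul_geomKernel hR M).comp (f := fun ζ ↦ (z j, ζ))
      (by fun_prop) fun ζ hζ ↦ ⟨mem_univ _, hζ⟩)
    (tendsto_div_pow_div_atTop_nhds_zero hρ0 hρR)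
    (fun M z hz ζ hζ ↦ norm_inv_sub_sub_inv_pow_mul_geomKernel_le hρR (hKρ z hz)
      (by simpa using hζ.ge)) (mul_pos hpi' hδ)).exists
  refine ⟨fun z ↦ (2 * Real.pi * Complex.I : ℂ)⁻¹ * ∮ ζ in C(0, R), f (update z j ζ) *
      ((ζ ^ M)⁻¹ * geomKernel M (z j) ζ), ?_, fun z hz ↦ ?_⟩
  · refine (differentiableOn_circleIntegral_update
      (κ := fun w ζ ↦ (ζ ^ M)⁻¹ * geomKernel M w ζ) hR.le (isOpen_setOf_forall_mem_norm_lt S ε)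
      hf
      (fun z hz ζ hζ ↦ hmaps z hz ζ (sphere_subset_closedBall hζ))
      (continuousOn_inv_pow_mul_geomKernel hR M)
      fun ζ _ ↦ (differentiable_geomKernel M ζ).const_mul _).const_mul _
  · have hφ : DifferentiableOn ℂ (fun ζ ↦ f (update z j ζ)) (closedBall 0 R) :=
      hf.comp (differentiable_update z j).differentiableOn (hmaps z (hKS z hz))
    have hcauchy := hφ.circleIntegral_sub_inv_smul (w := z j)
      (mem_ball_zero_iff.2 ((hKρ z hz).trans_lt hρR))
    simp only [smul_eq_mul, update_eq_self] at hcauchy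
    have hM' := hM z hz
    simp only [mul_comm _ ((_ : ℂ) - z j)⁻¹] at hM'
    rw [hcauchy] at hM'
    rw [← mul_lt_mul_iff_right₀ hpi', ← norm_mul, mul_sub, mul_inv_cancel_left₀ hpi]
    exact hM'

/-- Functions holomorphic on a polydisc can be approximated on compact sets by entire functions. -/
lemma exists_differentiable_norm_sub_lt {S : Finset (Fin n)}
    (hf : DifferentiableOn ℂ f {z | ∀ k ∈ S, ‖z k‖ < ε})
    (hK : IsCompact K) (hKD : K ⊆ {z | ∀ k ∈ S, ‖z k‖ < ε}) {δ : ℝ} (hδ : 0 < δ) :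
    ∃ g : (Fin n → ℂ) → ℂ, Differentiable ℂ g ∧ ∀ z ∈ K, ‖f z - g z‖ < δ := by
  induction S using Finset.induction_on generalizing f δ with
  | empty => exact ⟨f, by simpa [differentiableOn_univ] using hf, fun z _ ↦ by simpa using hδ⟩
  | insert j S _ ih =>
    obtain ⟨h, hh, hfh⟩ := exists_differentiableOn_norm_sub_lt_of_insert hf hK hKD (half_pos hδ)
    obtain ⟨g, hg, hhg⟩ := ih hh
      (fun z hz k hk ↦ hKD hz k (Finset.mem_insert_of_mem hk)) (half_pos hδ)
    refine ⟨g, hg, fun z hz ↦ ?_⟩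
    linarith [norm_sub_le_norm_sub_add_norm_sub (f z) (h z) (g z), hfh z hz, hhg z hz]

/-- A function holomorphic on a polydisc punctured along `z j = 0` can be approximated on compact
sets by quotients by powers of `z j` of functions holomorphic on the polydisc and entire in the
`j`-th coordinate. -/
lemma exists_differentiableOn_norm_sub_div_pow_lt {S : Finset (Fin n)}
    (hf : DifferentiableOn ℂ f {z | (∀ k ∈ insert j S, ‖z k‖ < ε) ∧ z j ≠ 0})
    (hK : IsCompact K) (hKD : K ⊆ {z | (∀ k ∈ insert j S, ‖z k‖ < ε) ∧ z j ≠ 0})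
    {δ : ℝ} (hδ : 0 < δ) :
    ∃ (N : ℕ) (g : (Fin n → ℂ) → ℂ), DifferentiableOn ℂ g {z | ∀ k ∈ S, ‖z k‖ < ε} ∧
      ∀ z ∈ K, ‖f z - g z / z j ^ N‖ < δ := by
  rcases K.eq_empty_or_nonempty with rfl | hne
  · exact ⟨0, 0, differentiableOn_const 0, by simp⟩
  obtain ⟨z₁, hz₁, hmax⟩ := hK.exists_isMaxOn hne (continuous_apply j).norm.continuousOn
  obtain ⟨z₂, hz₂, hmin⟩ := hK.exists_isMinOn hne (continuous_apply j).norm.continuousOn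
  set ρ := ‖z₁ j‖
  set σ := ‖z₂ j‖
  have hρ0 : 0 ≤ ρ := norm_nonneg _
  have hKρ : ∀ z ∈ K, ‖z j‖ ≤ ρ := fun z hz ↦ hmax hz
  have hKσ : ∀ z ∈ K, σ ≤ ‖z j‖ := fun z hz ↦ hmin hz
  obtain ⟨R, hρR, hRε⟩ := exists_between ((hKD hz₁).1 j (Finset.mem_insert_self j S))
  obtain ⟨r, hr, hrσ⟩ := exists_between (norm_pos_iff.2 (hKD hz₂).2)
  have hR : 0 < R := hρ0.trans_lt hρR
  have hrR : r < R := hrσ.trans_le ((hKσ z₁ hz₁).trans hρR.le)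
  set D := {z : Fin n → ℂ | (∀ k ∈ insert j S, ‖z k‖ < ε) ∧ z j ≠ 0}
  have hDo : IsOpen D := (isOpen_setOf_forall_mem_norm_lt _ ε).inter
    (isOpen_ne_fun (continuous_apply j) continuous_const)
  have hmaps : ∀ z ∈ {z : Fin n → ℂ | ∀ k ∈ S, ‖z k‖ < ε}, ∀ ζ : ℂ, 0 < ‖ζ‖ → ‖ζ‖ < ε →
      update z j ζ ∈ D := fun z hz ζ hζ0 hζ ↦
    ⟨update_mem_setOf_forall_mem_norm_lt hz hζ, by simpa using hζ0⟩
  have hmapsR : ∀ z ∈ {z : Fin n → ℂ | ∀ k ∈ S, ‖z k‖ < ε}, ∀ ζ ∈ sphere (0 : ℂ) R,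
      update z j ζ ∈ D := fun z hz ζ hζ ↦ by
    rw [mem_sphere_zero_iff_norm] at hζ
    exact hmaps z hz ζ (hζ ▸ hR) (hζ ▸ hRε)
  have hmapsr : ∀ z ∈ {z : Fin n → ℂ | ∀ k ∈ S, ‖z k‖ < ε}, ∀ ζ ∈ sphere (0 : ℂ) r,
      update z j ζ ∈ D := fun z hz ζ hζ ↦ by
    rw [mem_sphere_zero_iff_norm] at hζ
    exact hmaps z hz ζ (hζ ▸ hr) (hζ ▸ hrR.trans hRε)
  have hKS : ∀ z ∈ K, z ∈ {z : Fin n → ℂ | ∀ k ∈ S, ‖z k‖ < ε} := fun z hz k hk ↦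
    (hKD hz).1 k (Finset.mem_insert_of_mem hk)
  have hpi : (2 * Real.pi * Complex.I : ℂ) ≠ 0 := Complex.two_pi_I_ne_zero
  have hpi' : 0 < ‖(2 * Real.pi * Complex.I : ℂ)‖ := norm_pos_iff.2 hpi
  have hout := eventually_norm_circleIntegral_update_sub_lt (j := j)
    (κ := fun w ζ ↦ (ζ - w)⁻¹) (κ' := fun M w ζ ↦ (ζ ^ M)⁻¹ * geomKernel M w ζ) hR.le
    hf.continuousOn hK (fun z hz ζ hζ ↦ hmapsR z (hKS z hz) ζ hζ)
    (fun z hz ↦ continuousOn_inv_sub_sphere ((hKρ z hz).trans_lt hρR).ne)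
    (fun M z _ ↦ (continuousOn_inv_pow_mul_geomKernel hR M).comp (f := fun ζ ↦ (z j, ζ))
      (by fun_prop) fun ζ hζ ↦ ⟨mem_univ _, hζ⟩)
    (tendsto_div_pow_div_atTop_nhds_zero hρ0 hρR)
    (fun M z hz ζ hζ ↦ norm_inv_sub_sub_inv_pow_mul_geomKernel_le hρR (hKρ z hz)
      (by simpa using hζ.ge)) (half_pos (mul_pos hpi' hδ))
  have hin := eventually_norm_circleIntegral_update_sub_lt (j := j)
    (κ := fun w ζ ↦ (ζ - w)⁻¹) (κ' := fun M w ζ ↦ -((w ^ M)⁻¹ * geomKernel M w ζ)) hr.le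
    hf.continuousOn hK (fun z hz ζ hζ ↦ hmapsr z (hKS z hz) ζ hζ)
    (fun z hz ↦ continuousOn_inv_sub_sphere (hrσ.trans_le (hKσ z hz)).ne')
    (fun M z _ ↦ (((continuous_geomKernel M).comp (by fun_prop : Continuous fun ζ ↦ (z j, ζ))
      ).const_mul _).neg.continuousOn)
    (tendsto_div_pow_div_atTop_nhds_zero hr.le hrσ)
    (fun M z hz ζ hζ ↦ by
      have := norm_inv_sub_sub_inv_pow_mul_geomKernel_le (M := M) hrσ
        (mem_sphere_zero_iff_norm.1 hζ).le (hKσ z hz)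
      rwa [← norm_neg, neg_sub', ← inv_neg, neg_sub, geomKernel_comm] at this)
    (half_pos (mul_pos hpi' hδ))
  obtain ⟨M, hMout, hMin⟩ := (hout.and hin).exists
  refine ⟨M, fun z ↦ (2 * Real.pi * Complex.I : ℂ)⁻¹ *
    (z j ^ M * (∮ ζ in C(0, R), f (update z j ζ) * ((ζ ^ M)⁻¹ * geomKernel M (z j) ζ)) +
      ∮ ζ in C(0, r), f (update z j ζ) * geomKernel M (z j) ζ), ?_, fun z hz ↦ ?_⟩
  · have hS := isOpen_setOf_forall_mem_norm_lt S ε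
    refine ((DifferentiableOn.mul (by fun_prop) ?_).add ?_).const_mul _
    · exact differentiableOn_circleIntegral_update
        (κ := fun w ζ ↦ (ζ ^ M)⁻¹ * geomKernel M w ζ) hR.le hS hf hmapsR
        (continuousOn_inv_pow_mul_geomKernel hR M)
        fun ζ _ ↦ (differentiable_geomKernel M ζ).const_mul _
    · exact differentiableOn_circleIntegral_update hr.le hS hf hmapsr
        (continuous_geomKernel M).continuousOn fun ζ _ ↦ differentiable_geomKernel M ζ
  · have hz0 : z j ^ M ≠ 0 := pow_ne_zero _ (hKD hz).2
    have hcauchy := circleIntegral_div_sub_sub_circleIntegral_div_sub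
      (φ := fun ζ ↦ f (update z j ζ)) (V := update z j ⁻¹' D) hr
      (hrσ.trans_le (hKσ z hz)) ((hKρ z hz).trans_lt hρR)
      (hDo.preimage (differentiable_update z j).continuous)
      (fun ζ hζ ↦ hmaps z (hKS z hz) ζ (hr.trans_le (by simpa using hζ.2))
        ((mem_closedBall_zero_iff.1 hζ.1).trans_lt hRε))
      (hf.comp (differentiable_update z j).differentiableOn fun _ h ↦ h)
    simp only [update_eq_self] at hcauchy
    have hinner : (∮ ζ in C(0, r), f (update z j ζ) * -((z j ^ M)⁻¹ * geomKernel M (z j) ζ)) =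
        -((z j ^ M)⁻¹ * ∮ ζ in C(0, r), f (update z j ζ) * geomKernel M (z j) ζ) := by
      rw [← neg_mul, ← circleIntegral.integral_const_mul]
      congr 1 with ζ
      ring
    have h₁ := hMout z hz
    have h₂ := hMin z hz
    rw [hinner] at h₂
    rw [← mul_lt_mul_iff_right₀ hpi', ← norm_mul, mul_sub, ← hcauchy, mul_div_assoc',
      mul_inv_cancel_left₀ hpi, add_div, mul_div_cancel_left₀ _ hz0]
    refine lt_of_eq_of_lt (congrArg norm ?_) ((norm_sub_le _ _).trans_lt (add_lt_add h₁ h₂)) |>.trans_eq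
        (add_halves _)
    rw [div_eq_inv_mul]
    ring

end Polydisc

/-- Let `n ≥ 1`, `ε > 0`, and `Δ = {z ∈ ℂⁿ : |z_k| < ε for all k}` the open polydisc.
For every holomorphic function `f` on `Δ \ {z₁ = 0}`, every compact
`K ⊆ Δ \ {z₁ = 0}`, and every `δ > 0`, there exist `N ∈ ℕ` and an entire function
`g : ℂⁿ → ℂ` such that `|f(z) − g(z)/z₁^N| < δ` for all `z ∈ K`. In particular
`Δ \ {z₁ = 0}` is Runge in `ℂⁿ \ {z₁ = 0}`. -/
theorem stmt_16 (n : ℕ) (hn : 1 ≤ n) (ε : ℝ) (hε : 0 < ε) :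
    (∀ f : (Fin n → ℂ) → ℂ,
      DifferentiableOn ℂ f {z | (∀ k, ‖z k‖ < ε) ∧ z ⟨0, by omega⟩ ≠ 0} →
      ∀ K : Set (Fin n → ℂ), K ⊆ {z | (∀ k, ‖z k‖ < ε) ∧ z ⟨0, by omega⟩ ≠ 0} →
        IsCompact K →
        ∀ δ : ℝ, 0 < δ →
          ∃ (N : ℕ) (g : (Fin n → ℂ) → ℂ), Differentiable ℂ g ∧
            ∀ z ∈ K, ‖f z - g z / z ⟨0, by omega⟩ ^ N‖ < δ) ∧
    RungeIn n {z | (∀ k, ‖z k‖ < ε) ∧ z ⟨0, by omega⟩ ≠ 0}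
      {z | z ⟨0, by omega⟩ ≠ 0} := by
  have key : ∀ f : (Fin n → ℂ) → ℂ,
      DifferentiableOn ℂ f {z | (∀ k, ‖z k‖ < ε) ∧ z ⟨0, by omega⟩ ≠ 0} →
      ∀ K : Set (Fin n → ℂ), K ⊆ {z | (∀ k, ‖z k‖ < ε) ∧ z ⟨0, by omega⟩ ≠ 0} →
        IsCompact K →
        ∀ δ : ℝ, 0 < δ →
          ∃ (N : ℕ) (g : (Fin n → ℂ) → ℂ), Differentiable ℂ g ∧
            ∀ z ∈ K, ‖f z - g z / z ⟨0, by omega⟩ ^ N‖ < δ := by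
    intro f hf K hKD hK δ hδ
    set j : Fin n := ⟨0, by omega⟩
    have hD : {z : Fin n → ℂ | (∀ k, ‖z k‖ < ε) ∧ z j ≠ 0} =
        {z | (∀ k ∈ insert j Finset.univ, ‖z k‖ < ε) ∧ z j ≠ 0} := by
      simp
    rw [hD] at hf hKD
    obtain ⟨N, h, hh, hfh⟩ := exists_differentiableOn_norm_sub_div_pow_lt hf hK hKD (half_pos hδ)
    obtain ⟨m, hm, hKm⟩ : ∃ m > 0, ∀ z ∈ K, m ≤ ‖z j ^ N‖ := by
      rcases K.eq_empty_or_nonempty with rfl | hne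
      · exact ⟨1, one_pos, by simp⟩
      · obtain ⟨z₀, hz₀, hmin⟩ := hK.exists_isMinOn hne
          (((continuous_apply j).pow N).norm.continuousOn)
        exact ⟨‖z₀ j ^ N‖, norm_pos_iff.2 (pow_ne_zero _ (hKD hz₀).2), fun z hz ↦ hmin hz⟩
    obtain ⟨g, hg, hhg⟩ := exists_differentiable_norm_sub_lt hh hK
      (fun z hz k hk ↦ (hKD hz).1 k (Finset.mem_insert_of_mem hk)) (mul_pos (half_pos hδ) hm)
    refine ⟨N, g, hg, fun z hz ↦ ?_⟩
    have hle : ‖h z / z j ^ N - g z / z j ^ N‖ < δ / 2 := by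
      rw [← sub_div, norm_div, div_lt_iff₀ (hm.trans_le (hKm z hz))]
      exact (hhg z hz).trans_le (by gcongr; exact hKm z hz)
    linarith [norm_sub_le_norm_sub_add_norm_sub (f z) (h z / z j ^ N) (g z / z j ^ N), hfh z hz]
  refine ⟨key, fun f hf K hKD hK δ hδ ↦ ?_⟩
  obtain ⟨N, g, hg, hfg⟩ := key f hf K hKD hK δ hδ
  refine ⟨fun z ↦ g z / z ⟨0, by omega⟩ ^ N, ?_, hfg⟩
  simp only [div_eq_mul_inv]
  exact hg.differentiableOn.fun_mul
    (DifferentiableOn.fun_inv (by fun_prop) fun z hz ↦ pow_ne_zero N hz)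
end

section
/- For every n ≥ 2 there exist an open set Ω ⊆ ℂⁿ with Ω ⊆ {z ∈ ℂⁿ : z₁ ≠ 0} and a holomorphic bijection F : ℂⁿ → Ω whose inverse Ω → ℂⁿ is holomorphic, such that Ω is Runge in {z ∈ ℂⁿ : z₁ ≠ 0} but Ω is not Runge in ℂⁿ. That is, the Fatou–Bieberbach domain Ω (a proper biholomorphic copy of ℂⁿ inside ℂⁿ) avoids the hyperplane {z₁ = 0}, is Runge in the hyperplane complement, and is non-Runge in ℂⁿ. -/
open Set Filter Topology MeasureTheory
open scoped unitInterval

section Linearization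

variable {E : Type*} [NormedAddCommGroup E] [NormedSpace ℂ E]

/-- `T` fixes the origin, where it is tangent to the linear equivalence `L`, which halves norms;
the ball of radius `R` is so small that the nonlinear part of `T` is a tiny contraction there. -/
structure IsLinearizableOn (T : E → E) (L : E ≃L[ℂ] E) (C R : ℝ) : Prop where
  differentiable : Differentiable ℂ T
  map_zero : T 0 = 0
  norm_linear : ∀ x, ‖L x‖ = ‖x‖ / 2
  radius_pos : 0 < R
  const_nonneg : 0 ≤ C
  const_mul_le : C * R ≤ 0.07
  norm_sub_le : ∀ x ∈ Metric.ball (0 : E) R, ∀ y ∈ Metric.ball (0 : E) R,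
    ‖T x - T y - L (x - y)‖ ≤ C * max ‖x‖ ‖y‖ * ‖x - y‖

namespace IsLinearizableOn

variable {T : E → E} {L : E ≃L[ℂ] E} {C R : ℝ}

theorem norm_symm_iterate (h : IsLinearizableOn T L C R) (n : ℕ) (x : E) :
    ‖L.symm^[n] x‖ = 2 ^ n * ‖x‖ := by
  induction n generalizing x with
  | zero => simp
  | succ n ih =>
    have := h.norm_linear (L.symm x)
    rw [L.apply_symm_apply] at this
    rw [Function.iterate_succ_apply, ih, pow_succ, this]
    ring

theorem norm_map_sub_le (h : IsLinearizableOn T L C R) {x y : E} (hx : x ∈ Metric.ball 0 R)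
    (hy : y ∈ Metric.ball 0 R) : ‖T x - T y‖ ≤ 0.6 * ‖x - y‖ := by
  have h1 := h.norm_sub_le x hx y hy
  have h2 : ‖T x - T y‖ ≤ ‖T x - T y - L (x - y)‖ + ‖L (x - y)‖ := by
    simpa using norm_add_le (T x - T y - L (x - y)) (L (x - y))
  rw [h.norm_linear] at h2
  have h3 : C * max ‖x‖ ‖y‖ ≤ 0.07 := by
    refine le_trans ?_ h.const_mul_le
    have : max ‖x‖ ‖y‖ ≤ R := max_le (mem_ball_zero_iff.1 hx).le (mem_ball_zero_iff.1 hy).le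
    exact mul_le_mul_of_nonneg_left this h.const_nonneg
  nlinarith [norm_nonneg (x - y)]

theorem norm_map_le (h : IsLinearizableOn T L C R) {x : E} (hx : x ∈ Metric.ball 0 R) :
    ‖T x‖ ≤ 0.6 * ‖x‖ := by
  simpa [h.map_zero] using h.norm_map_sub_le hx (Metric.mem_ball_self h.radius_pos)

theorem norm_iterate_le (h : IsLinearizableOn T L C R) (n : ℕ) {x : E}
    (hx : x ∈ Metric.ball 0 R) : ‖T^[n] x‖ ≤ 0.6 ^ n * ‖x‖ ∧ T^[n] x ∈ Metric.ball 0 R := by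
  induction n with
  | zero => simpa using hx
  | succ n ih =>
    have h1 := h.norm_map_le ih.2
    have h2 := ih.2
    rw [Function.iterate_succ_apply']
    rw [mem_ball_zero_iff] at *
    refine ⟨by rw [pow_succ]; linarith, by linarith [norm_nonneg (T^[n] x)]⟩

theorem norm_iterate_sub_le (h : IsLinearizableOn T L C R) (n : ℕ) {x y : E}
    (hx : x ∈ Metric.ball 0 R) (hy : y ∈ Metric.ball 0 R) :
    ‖T^[n] x - T^[n] y‖ ≤ 0.6 ^ n * ‖x - y‖ := by
  induction n with
  | zero => simp
  | succ n ih =>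
    have h1 := h.norm_map_sub_le (h.norm_iterate_le n hx).2 (h.norm_iterate_le n hy).2
    rw [Function.iterate_succ_apply', Function.iterate_succ_apply', pow_succ]
    linarith

theorem norm_step_sub_le (h : IsLinearizableOn T L C R) (n : ℕ) {x y : E}
    (hx : x ∈ Metric.ball 0 R) (hy : y ∈ Metric.ball 0 R) :
    ‖(L.symm^[n + 1] (T^[n + 1] x) - L.symm^[n] (T^[n] x)) -
      (L.symm^[n + 1] (T^[n + 1] y) - L.symm^[n] (T^[n] y))‖ ≤
      0.14 * 0.72 ^ n * ‖x - y‖ := by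
  set a := T^[n] x with ha
  set b := T^[n] y with hb
  obtain ⟨ha1, ha2⟩ := h.norm_iterate_le n hx
  obtain ⟨hb1, hb2⟩ := h.norm_iterate_le n hy
  rw [← ha] at ha1 ha2
  rw [← hb] at hb1 hb2
  have key (v : E) : L.symm^[n] v = L.symm^[n + 1] (L v) := by
    rw [Function.iterate_succ_apply, L.symm_apply_apply]
  have e : (L.symm^[n + 1] (T^[n + 1] x) - L.symm^[n] a) -
      (L.symm^[n + 1] (T^[n + 1] y) - L.symm^[n] b) =
      L.symm^[n + 1] (T a - T b - L (a - b)) := by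
    rw [Function.iterate_succ_apply' T, Function.iterate_succ_apply' T, ← ha, ← hb, key, key,
      ← iterate_map_sub, ← iterate_map_sub, ← iterate_map_sub, map_sub]
    congr 1
    abel
  rw [e, h.norm_symm_iterate]
  have h1 := h.norm_sub_le a ha2 b hb2
  have h2 := h.norm_iterate_sub_le n hx hy
  rw [← ha, ← hb] at h2
  have h3 : max ‖a‖ ‖b‖ ≤ 0.6 ^ n * R := by
    rw [mem_ball_zero_iff] at hx hy
    exact max_le (ha1.trans (by gcongr)) (hb1.trans (by gcongr))
  have hC := h.const_nonneg
  have hR := h.radius_pos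
  calc 2 ^ (n + 1) * ‖T a - T b - L (a - b)‖
      ≤ 2 ^ (n + 1) * (C * (0.6 ^ n * R) * (0.6 ^ n * ‖x - y‖)) := by
        gcongr
        exact h1.trans (by gcongr)
    _ = 2 * (C * R) * (2 * (0.6 * 0.6)) ^ n * ‖x - y‖ := by
        rw [mul_pow, mul_pow, pow_succ]; ring
    _ ≤ 2 * 0.07 * (2 * (0.6 * 0.6)) ^ n * ‖x - y‖ := by
        gcongr
        exact h.const_mul_le
    _ = _ := by norm_num

theorem differentiable_iterate_symm (n : ℕ) : Differentiable ℂ (L.symm^[n]) := by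
  induction n with
  | zero => exact differentiable_id
  | succ n ih => exact ih.comp L.symm.differentiable

theorem differentiable_iterate {T : E → E} (hT : Differentiable ℂ T) (n : ℕ) :
    Differentiable ℂ (T^[n]) := by
  induction n with
  | zero => exact differentiable_id
  | succ n ih => exact ih.comp hT

theorem exists_local_linearization [CompleteSpace E] (h : IsLinearizableOn T L C R) :
    ∃ φ : E → E, TendstoUniformlyOn (fun n x => L.symm^[n] (T^[n] x)) φ atTop (Metric.ball 0 R) ∧
      (∀ x ∈ Metric.ball 0 R, DifferentiableAt ℂ φ x) ∧
      ApproximatesLinearOn φ ((ContinuousLinearEquiv.refl ℂ E : E ≃L[ℂ] E) : E →L[ℂ] E)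
        (Metric.ball 0 R) (1 / 2) := by
  set d : ℕ → E → E := fun n x => L.symm^[n + 1] (T^[n + 1] x) - L.symm^[n] (T^[n] x) with hd
  have hdd (n : ℕ) : Differentiable ℂ (d n) :=
    ((differentiable_iterate_symm _).comp (differentiable_iterate h.differentiable _)).sub
      ((differentiable_iterate_symm _).comp (differentiable_iterate h.differentiable _))
  have h0 : (0 : E) ∈ Metric.ball (0 : E) R := Metric.mem_ball_self h.radius_pos
  have hd0 (n : ℕ) : d n 0 = 0 := by
    have : ∀ n, T^[n] 0 = 0 := fun n => Function.iterate_fixed h.map_zero n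
    have h2 : ∀ n, L.symm^[n] 0 = 0 := fun n => Function.iterate_fixed (_root_.map_zero L.symm) n
    simp [hd, this, h2, -Function.iterate_succ]
  have hgeom : HasSum (fun n : ℕ => (0.14 : ℝ) * 0.72 ^ n) (1 / 2) := by
    convert! (hasSum_geometric_of_lt_one (r := (0.72 : ℝ)) (by norm_num) (by norm_num)).mul_left
      (0.14 : ℝ) using 1
    norm_num
  have hlip (n : ℕ) (x) (hx : x ∈ Metric.ball (0 : E) R) (y) (hy : y ∈ Metric.ball (0 : E) R) :
      ‖d n x - d n y‖ ≤ 0.14 * 0.72 ^ n * ‖x - y‖ := h.norm_step_sub_le n hx hy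
  have hbd (n : ℕ) (x) (hx : x ∈ Metric.ball (0 : E) R) :
      ‖d n x‖ ≤ 0.14 * 0.72 ^ n * R := by
    have := hlip n x hx 0 h0
    rw [hd0, sub_zero, sub_zero] at this
    rw [mem_ball_zero_iff] at hx
    exact this.trans (by gcongr)
  have hsum (x) (hx : x ∈ Metric.ball (0 : E) R) : Summable fun n => d n x :=
    Summable.of_norm_bounded (hgeom.summable.mul_right R) fun n => hbd n x hx
  have htel (n : ℕ) (x : E) : ∑ i ∈ Finset.range n, d i x = L.symm^[n] (T^[n] x) - x :=
    Finset.sum_range_sub (fun n => L.symm^[n] (T^[n] x)) n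
  refine ⟨fun x => ∑' n, d n x + x, ?_, fun x hx => ?_, fun x hx y hy => ?_⟩
  · have := tendstoUniformlyOn_tsum_nat (hgeom.summable.mul_right R) hbd
    rw [Metric.tendstoUniformlyOn_iff] at this ⊢
    intro ε hε
    filter_upwards [this ε hε] with n hn x hx
    have := hn x hx
    rw [htel, dist_eq_norm] at this
    rw [dist_eq_norm]
    convert this using 2
    abel
  · refine DifferentiableAt.add ?_ differentiableAt_id
    refine (hasFDerivAt_tsum_of_isPreconnected hgeom.summable Metric.isOpen_ball
      (convex_ball 0 R).isPreconnected (fun n y _ => (hdd n y).hasFDerivAt) (fun n y hy => ?_) h0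
      (hsum 0 h0) hx).differentiableAt
    have hn : (0 : ℝ) ≤ 0.14 * 0.72 ^ n := by positivity
    refine norm_fderiv_le_of_lipschitzOn ℂ (C := ⟨_, hn⟩) (Metric.isOpen_ball.mem_nhds hy) ?_
    exact LipschitzOnWith.of_dist_le_mul fun u hu v hv => by
      rw [dist_eq_norm, dist_eq_norm]
      exact hlip n u hu v hv
  · have e : (∑' n, d n x + x) - (∑' n, d n y + y) - (x - y) = ∑' n, (d n x - d n y) := by
      rw [(hsum x hx).tsum_sub (hsum y hy)]
      abel
    change ‖(∑' n, d n x + x) - (∑' n, d n y + y) - (x - y)‖ ≤ ((1 / 2 : NNReal) : ℝ) * _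
    rw [e]
    simpa using tsum_of_norm_bounded (hgeom.mul_right ‖x - y‖) fun n => hlip n x hx y hy

/-- The set of points attracted to the origin under iteration of `T`. -/
def basin (T : E → E) : Set E := {x | Tendsto (fun n => T^[n] x) atTop (𝓝 0)}

theorem mem_basin_iff (h : IsLinearizableOn T L C R) {x : E} :
    x ∈ basin T ↔ ∃ n, T^[n] x ∈ Metric.ball 0 R := by
  refine ⟨fun hx => (hx.eventually (Metric.ball_mem_nhds _ h.radius_pos)).exists, ?_⟩
  rintro ⟨m, hm⟩
  refine (tendsto_add_atTop_iff_nat m).1 ?_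
  simp only [Function.iterate_add_apply]
  refine squeeze_zero_norm (fun n => (h.norm_iterate_le n hm).1) ?_
  simpa using (tendsto_pow_atTop_nhds_zero_of_lt_one (r := (0.6 : ℝ)) (by norm_num)
    (by norm_num)).mul_const ‖T^[m] x‖

theorem iterate_mem_ball_of_le (h : IsLinearizableOn T L C R) {x : E} {m n : ℕ}
    (hx : T^[m] x ∈ Metric.ball 0 R) (hmn : m ≤ n) : T^[n] x ∈ Metric.ball 0 R := by
  obtain ⟨k, rfl⟩ := Nat.exists_eq_add_of_le' hmn
  rw [Function.iterate_add_apply]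
  exact (h.norm_iterate_le k hx).2

theorem isOpen_basin (h : IsLinearizableOn T L C R) : IsOpen (basin T) := by
  have : basin T = ⋃ n, T^[n] ⁻¹' Metric.ball 0 R := by
    ext x
    simp [h.mem_basin_iff]
  rw [this]
  exact isOpen_iUnion fun n =>
    Metric.isOpen_ball.preimage (differentiable_iterate h.differentiable n).continuous

theorem tendsto_iterate_linear (h : IsLinearizableOn T L C R) (y : E) :
    Tendsto (fun n => L^[n] y) atTop (𝓝 0) := by
  have e (n : ℕ) : ‖L^[n] y‖ = ‖y‖ * (1 / 2) ^ n := by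
    have := h.norm_symm_iterate n (L^[n] y)
    rw [Function.LeftInverse.iterate L.symm_apply_apply n y] at this
    rw [this, one_div, inv_pow]
    field_simp
  refine squeeze_zero_norm (fun n => (e n).le) ?_
  simpa using (tendsto_pow_atTop_nhds_zero_of_lt_one (r := (1 / 2 : ℝ)) (by norm_num)
    (by norm_num)).const_mul ‖y‖

end IsLinearizableOn

theorem ApproximatesLinearOn.differentiableAt_symm [CompleteSpace E] {φ : E → E}
    (e : OpenPartialHomeomorph E E) (he : ⇑e = φ)
    (hd : ∀ x ∈ e.source, DifferentiableAt ℂ φ x)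
    (ha : ApproximatesLinearOn φ ((ContinuousLinearEquiv.refl ℂ E : E ≃L[ℂ] E) : E →L[ℂ] E)
        e.source (1 / 2)) {y : E} (hy : y ∈ e.target) : DifferentiableAt ℂ e.symm y := by
  have hx := e.map_target hy
  set x := e.symm y
  have h1 : ‖1 - fderiv ℂ φ x‖ < 1 := by
    have h2 : HasFDerivAt (fun z => z - φ z) (1 - fderiv ℂ φ x) x :=
      (hasFDerivAt_id x).sub (hd x hx).hasFDerivAt
    refine (h2.le_of_lipschitzOn (e.open_source.mem_nhds hx) (C := 1 / 2) ?_).trans_lt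
      (by norm_num)
    refine LipschitzOnWith.of_dist_le_mul fun u hu v hv => ?_
    rw [dist_eq_norm, dist_eq_norm, ← norm_neg]
    convert! ha u hu v hv using 2
    change _ = φ u - φ v - (u - v)
    abel
  let f' := ContinuousLinearEquiv.unitsEquiv ℂ E (Units.oneSub _ h1)
  have hf' : (f' : E →L[ℂ] E) = fderiv ℂ φ x := by
    ext v
    change (1 - (1 - fderiv ℂ φ x)) v = _
    rw [sub_sub_cancel]
  refine (e.hasFDerivAt_symm (f' := f') hy ?_).differentiableAt
  rw [hf', he]
  exact (hd x hx).hasFDerivAt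

namespace IsLinearizableOn

/-- The basin of attraction of the fixed point of an automorphism is biholomorphic to the whole
space, through the limit of the maps `L⁻ⁿ ∘ Tⁿ`. -/
theorem exists_biholomorphism_basin [CompleteSpace E] {T : E ≃ E} {L : E ≃L[ℂ] E} {C R : ℝ}
    (h : IsLinearizableOn T L C R) (hT : Differentiable ℂ T.symm) :
    ∃ ψ χ : E → E, DifferentiableOn ℂ ψ (basin T) ∧ Differentiable ℂ χ ∧
      (∀ y, χ y ∈ basin T ∧ ψ (χ y) = y) ∧ (∀ x ∈ basin T, χ (ψ x) = x) ∧
      TendstoLocallyUniformlyOn (fun n x => L.symm^[n] (T^[n] x)) ψ atTop (basin T) := by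
  obtain ⟨φ, hlim, hφd, hφa⟩ := h.exists_local_linearization
  have h0 : (0 : E) ∈ Metric.ball (0 : E) R := Metric.mem_ball_self h.radius_pos
  have hTn (n : ℕ) : Differentiable ℂ (T^[n]) := differentiable_iterate h.differentiable n
  have hφ0 : φ 0 = 0 := by
    refine tendsto_nhds_unique (hlim.tendsto_at h0) ?_
    have h1 (n : ℕ) : T^[n] 0 = 0 := Function.iterate_fixed h.map_zero n
    have h2 (n : ℕ) : L.symm^[n] 0 = 0 := Function.iterate_fixed (_root_.map_zero L.symm) n
    simp [h1, h2]
  -- the limit exists on the basin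
  have hconv (m : ℕ) : TendstoUniformlyOn (fun n x => L.symm^[n] (T^[n] x))
      (fun x => L.symm^[m] (φ (T^[m] x))) atTop (T^[m] ⁻¹' Metric.ball 0 R) := by
    have huc : UniformContinuous (L.symm^[m]) := by
      induction m with
      | zero => exact uniformContinuous_id
      | succ m ih => exact ih.comp (L.symm : E →L[ℂ] E).uniformContinuous
    have h1 := huc.comp_tendstoUniformlyOn (hlim.comp T^[m])
    rw [Metric.tendstoUniformlyOn_iff] at h1 ⊢
    intro ε hε
    obtain ⟨N, hN⟩ := eventually_atTop.1 (h1 ε hε)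
    filter_upwards [eventually_ge_atTop (N + m)] with n hn x hx
    obtain ⟨k, rfl⟩ := Nat.exists_eq_add_of_le' (le_of_add_le_right hn)
    have := hN k (by omega) x hx
    rw [add_comm, Function.iterate_add_apply, add_comm, Function.iterate_add_apply]
    exact this
  let ψ : E → E := fun x => limUnder atTop fun n => L.symm^[n] (T^[n] x)
  have hψ (m : ℕ) (x : E) (hx : T^[m] x ∈ Metric.ball 0 R) : ψ x = L.symm^[m] (φ (T^[m] x)) :=
    ((hconv m).tendsto_at hx).limUnder_eq
  have hopen (m : ℕ) : IsOpen (T^[m] ⁻¹' Metric.ball 0 R) :=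
    Metric.isOpen_ball.preimage (hTn m).continuous
  have hinj : InjOn ψ (basin T) := by
    intro x hx y hy hxy
    obtain ⟨m, hm⟩ := h.mem_basin_iff.1 hx
    obtain ⟨k, hk⟩ := h.mem_basin_iff.1 hy
    have hm' := h.iterate_mem_ball_of_le hm (le_max_left m k)
    have hk' := h.iterate_mem_ball_of_le hk (le_max_right m k)
    rw [hψ _ _ hm', hψ _ _ hk'] at hxy
    have h1 := L.symm.injective.iterate _ hxy
    have h2 : InjOn φ (Metric.ball 0 R) := by
      intro u hu v hv huv
      have := hφa u hu v hv
      simp only [huv, sub_self, zero_sub, norm_neg, ContinuousLinearEquiv.coe_coe,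
        ContinuousLinearEquiv.coe_refl', id_eq] at this
      rw [← sub_eq_zero, ← norm_le_zero_iff]
      norm_num at this
      linarith
    exact T.injective.iterate _ (h2 hm' hk' h1)
  obtain ⟨e, hes, hec⟩ : ∃ e : OpenPartialHomeomorph E E, e.source = Metric.ball 0 R ∧ ⇑e = φ := by
    refine ⟨hφa.toOpenPartialHomeomorph φ (Metric.ball 0 R) ?_ Metric.isOpen_ball, rfl, rfl⟩
    rcases subsingleton_or_nontrivial E with hE | hE
    · exact Or.inl hE
    · refine Or.inr ?_
      have : ‖(((ContinuousLinearEquiv.refl ℂ E).symm : E ≃L[ℂ] E) : E →L[ℂ] E)‖₊ = 1 :=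
        
        NNReal.eq ContinuousLinearMap.norm_id
      rw [this]
      norm_num
  have h0t : (0 : E) ∈ e.target := by
    have := e.map_source (hes ▸ h0)
    rwa [hec, hφ0] at this
  have hinv (m : ℕ) (y : E) (hy : L^[m] y ∈ e.target) :
      T.symm^[m] (e.symm (L^[m] y)) ∈ basin T ∧ ψ (T.symm^[m] (e.symm (L^[m] y))) = y := by
    have h1 : T^[m] (T.symm^[m] (e.symm (L^[m] y))) = e.symm (L^[m] y) :=
      Function.LeftInverse.iterate T.apply_symm_apply m _
    have h2 : T^[m] (T.symm^[m] (e.symm (L^[m] y))) ∈ Metric.ball 0 R := by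
      rw [h1, ← hes]
      exact e.map_target hy
    refine ⟨h.mem_basin_iff.2 ⟨m, h2⟩, ?_⟩
    rw [hψ m _ h2, h1, ← hec, e.right_inv hy]
    exact Function.LeftInverse.iterate L.symm_apply_apply m y
  have hev (y : E) : ∃ m, L^[m] y ∈ e.target :=
    ((h.tendsto_iterate_linear y).eventually (e.open_target.mem_nhds h0t)).exists
  have hsurj (y : E) : ∃ x ∈ basin T, ψ x = y := by
    obtain ⟨m, hm⟩ := hev y
    exact ⟨_, (hinv m y hm).1, (hinv m y hm).2⟩
  choose χ hχ hψχ using hsurj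
  refine ⟨ψ, χ, fun x hx => ?_, fun y => ?_, fun y => ⟨hχ y, hψχ y⟩,
    fun x hx => hinj (hχ _) hx (hψχ _), ?_⟩
  · obtain ⟨m, hm⟩ := h.mem_basin_iff.1 hx
    refine DifferentiableAt.differentiableWithinAt ?_
    refine DifferentiableAt.congr_of_eventuallyEq (f := L.symm^[m] ∘ φ ∘ T^[m]) ?_ ?_
    · exact (differentiable_iterate_symm m _).comp x ((hφd _ hm).comp x (hTn m x))
    · filter_upwards [(hopen m).mem_nhds hm] with z hz using hψ m z hz
  · obtain ⟨m, hm⟩ := hev y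
    have hLm : Differentiable ℂ (L^[m]) := differentiable_iterate L.differentiable m
    have hsymm : DifferentiableAt ℂ e.symm (L^[m] y) :=
      ApproximatesLinearOn.differentiableAt_symm e hec (fun x hx => hφd x (hes ▸ hx))
        (hes ▸ hφa) hm
    refine DifferentiableAt.congr_of_eventuallyEq (f := T.symm^[m] ∘ e.symm ∘ L^[m]) ?_ ?_
    · exact (differentiable_iterate hT m _).comp y (hsymm.comp y (hLm y))
    · filter_upwards [(e.open_target.preimage hLm.continuous).mem_nhds hm] with z hz
      exact hinj (hχ z) (hinv m z hz).1 ((hψχ z).trans (hinv m z hz).2.symm)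
  · intro u hu x hx
    obtain ⟨m, hm⟩ := h.mem_basin_iff.1 hx
    exact ⟨_, mem_nhdsWithin_of_mem_nhds ((hopen m).mem_nhds hm),
      ((hconv m).congr_right fun z hz => (hψ m z hz).symm) u hu⟩

end IsLinearizableOn

end Linearization

section FatouBieberbach

theorem ContDiff.exists_norm_sub_linear_le {E : Type*} [NormedAddCommGroup E] [NormedSpace ℂ E]
    {T : E → E} (hT : ContDiff ℂ 2 T) {L : E →L[ℂ] E} (hL : HasFDerivAt T L 0) :
    ∃ C R : ℝ, 0 < R ∧ 0 ≤ C ∧ C * R ≤ 0.07 ∧ ∀ x ∈ Metric.ball (0 : E) R,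
      ∀ y ∈ Metric.ball (0 : E) R, ‖T x - T y - L (x - y)‖ ≤ C * max ‖x‖ ‖y‖ * ‖x - y‖ := by
  have hd : ContDiff ℂ 1 (fderiv ℂ T) := hT.fderiv_right (by norm_num)
  obtain ⟨K, s, hs, hK⟩ := hd.contDiffAt.exists_lipschitzOnWith (x := (0 : E))
  obtain ⟨r, hr, hrs⟩ := Metric.mem_nhds_iff.1 hs
  have hK0 : (0 : ℝ) < K + 1 := by positivity
  refine ⟨K + 1, min r (0.07 / (K + 1)), lt_min hr (by positivity), hK0.le, ?_,
    fun x hx y hy => ?_⟩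
  · calc ((K : ℝ) + 1) * min r (0.07 / (K + 1)) ≤ (K + 1) * (0.07 / (K + 1)) := by
          gcongr; exact min_le_right _ _
      _ = 0.07 := by field_simp
  · rw [mem_ball_zero_iff, lt_min_iff] at hx hy
    refine (convex_closedBall (0 : E) (max ‖x‖ ‖y‖)).norm_image_sub_le_of_norm_fderiv_le'
      (fun z _ => hT.differentiable (by norm_num) z) (fun z hz => ?_) (by simp) (by simp)
    rw [mem_closedBall_zero_iff] at hz
    have hzs : z ∈ s := hrs (mem_ball_zero_iff.2 (hz.trans_lt (max_lt hx.1 hy.1)))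
    have := hK.dist_le_mul z hzs 0 (hrs (Metric.mem_ball_self hr))
    rw [dist_eq_norm, hL.fderiv, dist_zero_right] at this
    have hz0 := norm_nonneg z
    nlinarith [K.coe_nonneg]

/-- The overshear `(u, w) ↦ ((1 + u) * exp (w / 2) - 1, w)`. -/
noncomputable def overshear : (ℂ × ℂ) ≃ (ℂ × ℂ) where
  toFun p := ((1 + p.1) * Complex.exp (p.2 / 2) - 1, p.2)
  invFun p := ((1 + p.1) * Complex.exp (-(p.2 / 2)) - 1, p.2)
  left_inv p := by
    ext
    · simp [mul_assoc, ← Complex.exp_add]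
    · rfl
  right_inv p := by
    ext
    · simp [mul_assoc, ← Complex.exp_add]
    · rfl

/-- The shear `(u, w) ↦ (u, w - 2 * u)`. -/
noncomputable def linearShear : (ℂ × ℂ) ≃ (ℂ × ℂ) where
  toFun p := (p.1, p.2 - 2 * p.1)
  invFun p := (p.1, p.2 + 2 * p.1)
  left_inv p := by simp
  right_inv p := by simp

/-- The dilation `(u, w) ↦ (u, w / 4)`. -/
noncomputable def dilation : (ℂ × ℂ) ≃ (ℂ × ℂ) where
  toFun p := (p.1, p.2 / 4)
  invFun p := (p.1, p.2 * 4)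
  left_inv p := by simp
  right_inv p := by simp

/-- An automorphism of `ℂ²` with an attracting fixed point at the origin and an invariant line
`1 + u = 0`. -/
noncomputable def attractor : (ℂ × ℂ) ≃ (ℂ × ℂ) :=
  overshear.trans (linearShear.trans (overshear.trans dilation))

/-- The linear part `(u, w) ↦ (w / 2, -u / 2)` of `attractor` at the origin. -/
noncomputable def attractorLinear : (ℂ × ℂ) ≃L[ℂ] (ℂ × ℂ) :=
  ContinuousLinearEquiv.equivOfInverse
    (((1 / 2 : ℂ) • ContinuousLinearMap.snd ℂ ℂ ℂ).prod
      ((-1 / 2 : ℂ) • ContinuousLinearMap.fst ℂ ℂ ℂ))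
    (((-2 : ℂ) • ContinuousLinearMap.snd ℂ ℂ ℂ).prod ((2 : ℂ) • ContinuousLinearMap.fst ℂ ℂ ℂ))
    (fun p => by ext <;> simp; ring) (fun p => by ext <;> simp; ring)

theorem attractorLinear_apply (p : ℂ × ℂ) : attractorLinear p = (1 / 2 * p.2, -1 / 2 * p.1) := rfl

theorem norm_attractorLinear (p : ℂ × ℂ) : ‖attractorLinear p‖ = ‖p‖ / 2 := by
  rw [attractorLinear_apply, Prod.norm_def, Prod.norm_def, max_comm]
  simp only [norm_mul, norm_div, norm_neg, norm_one, Complex.norm_ofNat]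
  rw [← mul_max_of_nonneg _ _ (by norm_num)]
  ring

theorem attractor_apply (p : ℂ × ℂ) : attractor p = dilation (overshear (linearShear
    (overshear p))) := rfl

theorem contDiff_attractor : ContDiff ℂ 2 attractor := by
  unfold attractor overshear linearShear dilation
  simp only [Equiv.coe_trans, Equiv.coe_fn_mk]
  fun_prop

theorem differentiable_attractor_symm : Differentiable ℂ attractor.symm := by
  change Differentiable ℂ
    (overshear.symm ∘ linearShear.symm ∘ overshear.symm ∘ dilation.symm)
  unfold overshear linearShear dilation
  simp only [Equiv.coe_fn_symm_mk]
  fun_prop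

theorem hasFDerivAt_overshear_zero : HasFDerivAt overshear
    ((ContinuousLinearMap.fst ℂ ℂ ℂ + (1 / 2 : ℂ) • ContinuousLinearMap.snd ℂ ℂ ℂ).prod
      (ContinuousLinearMap.snd ℂ ℂ ℂ)) 0 := by
  have h1 : HasFDerivAt (fun p : ℂ × ℂ => 1 + p.1) (ContinuousLinearMap.fst ℂ ℂ ℂ) 0 :=
    hasFDerivAt_fst.const_add 1
  have h2 : HasFDerivAt (fun p : ℂ × ℂ => p.2 / 2)
      ((1 / 2 : ℂ) • ContinuousLinearMap.snd ℂ ℂ ℂ) 0 := by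
    convert! (hasFDerivAt_snd (𝕜 := ℂ) (p := (0 : ℂ × ℂ))).const_mul (1 / 2 : ℂ) using 2
    ring
  refine HasFDerivAt.prodMk ?_ hasFDerivAt_snd
  convert! (h1.mul h2.cexp).sub_const 1 using 1
  ext <;> simp

theorem hasFDerivAt_attractor_zero :
    HasFDerivAt attractor (attractorLinear : ℂ × ℂ →L[ℂ] ℂ × ℂ) 0 := by
  have ho : overshear 0 = 0 := by simp [overshear]
  have hs : linearShear 0 = 0 := by simp [linearShear]
  have h1 : HasFDerivAt linearShear ((ContinuousLinearMap.fst ℂ ℂ ℂ).prod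
      (ContinuousLinearMap.snd ℂ ℂ ℂ - (2 : ℂ) • ContinuousLinearMap.fst ℂ ℂ ℂ)) 0 :=
    hasFDerivAt_fst.prodMk (hasFDerivAt_snd.sub (hasFDerivAt_fst.const_mul 2))
  have h2 : HasFDerivAt dilation ((ContinuousLinearMap.fst ℂ ℂ ℂ).prod
      ((1 / 4 : ℂ) • ContinuousLinearMap.snd ℂ ℂ ℂ)) 0 := by
    refine hasFDerivAt_fst.prodMk ?_
    convert! (hasFDerivAt_snd (𝕜 := ℂ) (p := (0 : ℂ × ℂ))).const_mul (1 / 4 : ℂ) using 2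
    exact div_eq_inv_mul _ _ |>.trans (by rw [one_div])
  have h3 := hasFDerivAt_overshear_zero
  have h4 : HasFDerivAt (linearShear ∘ overshear) _ 0 := (ho.symm ▸ h1).comp 0 h3
  have h5 : HasFDerivAt (overshear ∘ linearShear ∘ overshear) _ 0 :=
    HasFDerivAt.comp 0 (by simpa [ho, hs] using h3) h4
  have h6 : HasFDerivAt (dilation ∘ overshear ∘ linearShear ∘ overshear) _ 0 :=
    HasFDerivAt.comp 0 (by simpa [ho, hs] using h2) h5
  refine h6.congr_fderiv ?_
  ext <;> simp [attractorLinear_apply]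
  ring

theorem one_add_attractor_fst_eq_zero {p : ℂ × ℂ} (hp : 1 + p.1 = 0) :
    1 + (attractor p).1 = 0 := by
  simp [attractor_apply, dilation, overshear, linearShear, hp]

/-- A Fatou–Bieberbach domain in `ℂ²` avoiding a line, together with entire maps converging to its
parametrization. -/
theorem exists_fatouBieberbach_domain : ∃ (V : Set (ℂ × ℂ)) (ψ χ : ℂ × ℂ → ℂ × ℂ)
    (H : ℕ → ℂ × ℂ → ℂ × ℂ), IsOpen V ∧ 0 ∈ V ∧ (∀ p ∈ V, 1 + p.1 ≠ 0) ∧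
      DifferentiableOn ℂ ψ V ∧ Differentiable ℂ χ ∧ (∀ y, χ y ∈ V ∧ ψ (χ y) = y) ∧
      (∀ x ∈ V, χ (ψ x) = x) ∧ (∀ n, Differentiable ℂ (H n)) ∧
      TendstoLocallyUniformlyOn H ψ atTop V := by
  obtain ⟨C, R, hR, hC, hCR, hle⟩ :=
    contDiff_attractor.exists_norm_sub_linear_le hasFDerivAt_attractor_zero
  have h : IsLinearizableOn attractor attractorLinear C R :=
    ⟨contDiff_attractor.differentiable (by norm_num),
      by simp [attractor_apply, dilation, overshear, linearShear], norm_attractorLinear,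
      hR, hC, hCR, hle⟩
  obtain ⟨ψ, χ, hψ, hχ, hψχ, hχψ, hlim⟩ :=
    h.exists_biholomorphism_basin differentiable_attractor_symm
  refine ⟨IsLinearizableOn.basin attractor, ψ, χ, _, h.isOpen_basin,
    h.mem_basin_iff.2 ⟨0, Metric.mem_ball_self hR⟩, fun p hp h0 => ?_, hψ, hχ, hψχ, hχψ,
    fun n => (IsLinearizableOn.differentiable_iterate_symm n).comp
      (IsLinearizableOn.differentiable_iterate h.differentiable n), hlim⟩
  have hn (n : ℕ) : (attractor^[n] p).1 = -1 := by
    refine eq_neg_of_add_eq_zero_right ?_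
    induction n with
    | zero => exact h0
    | succ n ih =>
      rw [Function.iterate_succ_apply']
      exact one_add_attractor_fst_eq_zero ih
  have h1 : Tendsto (fun n => (attractor^[n] p).1) atTop (𝓝 0) :=
    (continuous_fst.tendsto (0 : ℂ × ℂ)).comp hp
  simp only [hn, tendsto_const_nhds_iff] at h1
  norm_num at h1

end FatouBieberbach
theorem Subalgebra.tsum_geometric_mem_topologicalClosure {R : Type*} [NormedRing R]
    [NormedAlgebra ℂ R] [CompleteSpace R] {A : Subalgebra ℂ R} {x : R}
    (hx : x ∈ A.topologicalClosure) (h : ‖x‖ < 1) : ∑' i : ℕ, x ^ i ∈ A.topologicalClosure :=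
  A.isClosed_topologicalClosure.mem_of_tendsto
    (summable_geometric_of_norm_lt_one h).hasSum
    (Eventually.of_forall fun _ => sum_mem fun i _ => pow_mem hx i)

theorem Complex.one_add_mul_sub_one_mem_slitPlane {z : ℂ} (hz : z ∈ slitPlane) {t : ℝ}
    (ht0 : 0 ≤ t) (ht1 : t ≤ 1) : 1 + t * (z - 1) ∈ slitPlane := by
  have := Complex.starConvex_one_slitPlane hz (a := 1 - t) (b := t) (by linarith) ht0 (by ring)
  convert! this using 1
  simp only [real_smul, ofReal_sub, ofReal_one]
  ring

/-- On a compact subset of the slit plane the logarithm is a uniform limit of polynomials. -/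
theorem Complex.exists_polynomial_norm_sub_log_lt {P : Set ℂ} (hP : IsCompact P)
    (hPs : P ⊆ slitPlane) {ε : ℝ} (hε : 0 < ε) :
    ∃ p : Polynomial ℂ, ∀ z ∈ P, ‖p.eval z - log z‖ < ε := by
  have : CompactSpace P := isCompact_iff_compactSpace.1 hP
  set A := polynomialFunctions P
  have hne (t : I) (z : P) : 1 + (t : ℂ) * ((z : ℂ) - 1) ≠ 0 :=
    slitPlane_ne_zero (one_add_mul_sub_one_mem_slitPlane (hPs z.2) t.2.1 t.2.2)
  let u₀ : C(I × P, ℂ) := ⟨fun x => (1 + ((x.1 : ℝ) : ℂ) * ((x.2 : ℂ) - 1))⁻¹, by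
    refine Continuous.inv₀ (by fun_prop) fun x => hne x.1 x.2⟩
  let u : C(I, C(P, ℂ)) := u₀.curry
  have hu (t : I) (z : P) : u t z = (1 + ((t : ℝ) : ℂ) * ((z : ℂ) - 1))⁻¹ := rfl
  let v : C(P, ℂ) := ⟨fun z => (z : ℂ) - 1, by fun_prop⟩
  have hvA : v ∈ A := ⟨Polynomial.X - 1, by simp, by ext z; simp [v]⟩
  have hvA' := A.le_topologicalClosure hvA
  let S : Set I := {t | u t ∈ A.topologicalClosure}
  have hScl : IsClosed S := A.isClosed_topologicalClosure.preimage u.continuous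
  have hSop : IsOpen S := by
    rw [isOpen_iff_mem_nhds]
    intro t ht
    have hlim : Tendsto (fun s : I => ‖((t : ℂ) - (s : ℂ)) • (v * u t)‖) (𝓝 t) (𝓝 0) := by
      have : Continuous (fun s : I => ‖((t : ℂ) - (s : ℂ)) • (v * u t)‖) := by fun_prop
      simpa using this.tendsto t
    filter_upwards [hlim.eventually_lt_const one_pos] with s hs
    set x := ((t : ℂ) - (s : ℂ)) • (v * u t)
    have hx : x ∈ A.topologicalClosure :=
      Subalgebra.smul_mem _ (mul_mem hvA' ht) _
    have key : u s = u t * ∑' i : ℕ, x ^ i := by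
      have h1 : (1 - x) * ∑' i : ℕ, x ^ i = 1 := mul_neg_geom_series x hs
      have h2 : u t = u s * (1 - x) := by
        ext z
        simp only [x, ContinuousMap.mul_apply, ContinuousMap.sub_apply, ContinuousMap.one_apply,
          ContinuousMap.smul_apply, hu, smul_eq_mul, v, ContinuousMap.coe_mk]
        rw [eq_inv_mul_iff_mul_eq₀ (hne s z)]
        linear_combination mul_inv_cancel₀ (hne t z)
      rw [h2, mul_assoc, h1, mul_one]
    change u s ∈ A.topologicalClosure
    rw [key]
    exact mul_mem ht (Subalgebra.tsum_geometric_mem_topologicalClosure hx hs)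
  have hS : S = univ := by
    refine IsClopen.eq_univ ⟨hScl, hSop⟩ ⟨0, ?_⟩
    have : u 0 = 1 := by ext z; simp [hu]
    change u 0 ∈ A.topologicalClosure
    rw [this]
    exact one_mem _
  have hint : Integrable (fun t => u t) (volume : Measure I) :=
    u.continuous.integrable_of_hasCompactSupport (HasCompactSupport.of_compactSpace _)
  have hw : (∫ t, u t) ∈ A.topologicalClosure :=
    Convex.integral_mem (s := (A.topologicalClosure : Set C(P, ℂ)))
      (Submodule.convex (A.topologicalClosure.toSubmodule.restrictScalars ℝ))
      A.isClosed_topologicalClosure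
      (Eventually.of_forall fun t => by
        have : t ∈ S := hS ▸ mem_univ t
        exact this) hint
  have hlog (z : P) : (v * ∫ t, u t) z = log z := by
    have h1 : (∫ t, u t) z = ∫ t, u t z :=
      ((ContinuousMap.evalCLM ℂ z).integral_comp_comm hint).symm
    have h2 := log_eq_integral (z := (z : ℂ) - 1) (by simpa using hPs z.2)
    rw [ContinuousMap.mul_apply, h1]
    simp only [hu]
    rw [intervalIntegral.integral_of_le zero_le_one, ← integral_Icc_eq_integral_Ioc,
      ← integral_subtype measurableSet_Icc] at h2
    simpa [v] using h2.symm
  have hmem : v * ∫ t, u t ∈ closure (A : Set C(P, ℂ)) := mul_mem hvA' hw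
  obtain ⟨_, ⟨p, -, rfl⟩, hp⟩ := Metric.mem_closure_iff.1 hmem ε hε
  refine ⟨p, fun z hz => ?_⟩
  have := (ContinuousMap.dist_apply_le_dist (⟨z, hz⟩ : P)).trans_lt hp
  rw [dist_comm, dist_eq_norm, hlog] at this
  simpa using this
/-- The part of the family of discs over the arc `‖z + 1/2‖ = 1`, `0.6 ≤ ‖z‖`. -/
def leftPiece (c a : ℂ → ℂ) : Set (ℂ × ℂ) :=
  (fun q : ℂ × ℂ => (q.1, c q.1 + a q.1 * q.2)) ''
    ({z | ‖z + 1 / 2‖ = 1 ∧ 0.6 ≤ ‖z‖} ×ˢ Metric.closedBall 0 1)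

/-- The product of the arc `‖z‖ = 1`, `0.1 ≤ ‖z + 1‖` and the closed unit disc. -/
def rightPiece : Set (ℂ × ℂ) := {z | ‖z‖ = 1 ∧ 0.1 ≤ ‖z + 1‖} ×ˢ Metric.closedBall 0 1

/-- An entire function which has modulus at least one at the origin also does so somewhere on
`leftPiece c a ∪ rightPiece`. -/
theorem exists_mem_pieces_one_le_norm {f : ℂ × ℂ → ℂ} {c a : ℂ → ℂ} (hf : Differentiable ℂ f)
    (hc : Differentiable ℂ c) (ha : Differentiable ℂ a)
    (gap₁ : ∀ z, ‖z + 1 / 2‖ = 1 → ‖z‖ < 0.6 → ‖c z‖ + ‖a z‖ ≤ 1)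
    (gap₂ : ∀ z, ‖z‖ = 1 → ‖z + 1‖ < 0.1 → ‖c z‖ + 1 ≤ ‖a z‖) (h0 : 1 ≤ ‖f (0, 0)‖) :
    ∃ p ∈ leftPiece c a ∪ rightPiece, 1 ≤ ‖f p‖ := by
  by_contra! H
  set D : Set ℂ := Metric.closedBall 0 1
  set B : Set ℂ := Metric.ball (-1 / 2) 1
  have hBcl : closure B = Metric.closedBall (-1 / 2) 1 := closure_ball _ one_ne_zero
  have hD : IsCompact D := isCompact_closedBall _ _
  have hB : IsCompact (closure B) := hBcl ▸ isCompact_closedBall _ _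
  have memB (z : ℂ) : z ∈ closure B ↔ ‖z + 1 / 2‖ ≤ 1 := by
    rw [hBcl, mem_closedBall_iff_norm, neg_div, sub_neg_eq_add]
  let φ : ℂ × ℂ → ℂ := fun q => f (q.1, c q.1 + a q.1 * q.2)
  have hφ : Differentiable ℂ φ := by fun_prop
  obtain ⟨⟨z₁, s₁⟩, h₁, hmax₁⟩ := (hB.prod hD).exists_isMaxOn
    ⟨((-1 / 2 : ℂ), (0 : ℂ)), ⟨(memB _).2 (by norm_num), by simp [D]⟩⟩
    hφ.continuous.norm.continuousOn
  obtain ⟨⟨z₂, w₂⟩, h₂, hmax₂⟩ := (hD.prod hD).exists_isMaxOn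
    ⟨((0 : ℂ), (0 : ℂ)), by simp [D]⟩ hf.continuous.norm.continuousOn
  have hM₂ : 1 ≤ ‖f (z₂, w₂)‖ := h0.trans (hmax₂ (by simp [D] : ((0 : ℂ), (0 : ℂ)) ∈ D ×ˢ D))
  -- the maximum over the bidisc is attained over its distinguished circle
  obtain ⟨z₂', hz₂', hmax₂'⟩ := Complex.exists_mem_frontier_isMaxOn_norm
    (Metric.isBounded_ball (x := (0 : ℂ)) (r := 1)) ⟨0, by simp⟩
    (f := fun z => f (z, w₂)) (Differentiable.diffContOnCl (by fun_prop))
  have hle₂ : ‖f (z₂, w₂)‖ ≤ ‖f (z₂', w₂)‖ := hmax₂' (by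
    rw [closure_ball _ one_ne_zero]; exact h₂.1)
  have hz₂n : ‖z₂'‖ = 1 := by
    rw [frontier_ball _ one_ne_zero] at hz₂'
    simpa using hz₂'
  have hz₂a : ‖z₂' + 1‖ < 0.1 := by
    by_contra! h
    exact absurd (hM₂.trans hle₂) (H (z₂', w₂) (Or.inr ⟨⟨hz₂n, h⟩, h₂.2⟩)).not_ge
  have hw₂ : ‖w₂‖ ≤ 1 := by simpa [D] using h₂.2
  have hg₂ := gap₂ _ hz₂n hz₂a
  have ha₂ : 0 < ‖a z₂'‖ := by linarith [norm_nonneg (c z₂')]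
  set s := (w₂ - c z₂') / a z₂' with hs
  have hsD : s ∈ D := by
    simp only [D, mem_closedBall_zero_iff, hs, norm_div]
    rw [div_le_one ha₂]
    linarith [norm_sub_le w₂ (c z₂')]
  have hφs : φ (z₂', s) = f (z₂', w₂) := by
    simp only [φ, hs]
    rw [mul_div_cancel₀ _ (norm_pos_iff.1 ha₂), add_sub_cancel]
  have hz₂B : z₂' ∈ B := by
    rw [mem_ball_iff_norm]
    calc ‖z₂' - -1 / 2‖ = ‖(z₂' + 1) + (-1 / 2 : ℂ)‖ := by ring_nf
      _ ≤ ‖z₂' + 1‖ + ‖(-1 / 2 : ℂ)‖ := norm_add_le _ _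
      _ < 1 := by norm_num at hz₂a ⊢; linarith
  have hle₁₂ : ‖φ (z₂', s)‖ ≤ ‖φ (z₁, s₁)‖ := hmax₁ ⟨subset_closure hz₂B, hsD⟩
  -- likewise for the family of discs
  obtain ⟨z₁', hz₁', hmax₁'⟩ := Complex.exists_mem_frontier_isMaxOn_norm
    (Metric.isBounded_ball (x := (-1 / 2 : ℂ)) (r := 1)) ⟨_, hz₂B⟩
    (f := fun z => φ (z, s₁)) (Differentiable.diffContOnCl (by fun_prop))
  have hle₁ : ‖φ (z₁, s₁)‖ ≤ ‖φ (z₁', s₁)‖ := hmax₁' h₁.1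
  have hz₁n : ‖z₁' + 1 / 2‖ = 1 := by
    rw [frontier_ball _ one_ne_zero, mem_sphere_iff_norm, neg_div, sub_neg_eq_add] at hz₁'
    exact hz₁'
  have hz₁a : ‖z₁'‖ < 0.6 := by
    by_contra! h
    have : φ (z₁', s₁) = f (z₁', c z₁' + a z₁' * s₁) := rfl
    exact absurd (hM₂.trans (hle₂.trans (hφs ▸ hle₁₂.trans hle₁)))
      (H _ (Or.inl ⟨(z₁', s₁), ⟨⟨hz₁n, h⟩, h₁.2⟩, rfl⟩)).not_ge
  have hs₁ : ‖s₁‖ ≤ 1 := by simpa [D] using h₁.2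
  have hle₂₁ : ‖φ (z₁', s₁)‖ ≤ ‖f (z₂, w₂)‖ := hmax₂ ⟨by
      simp only [D, mem_closedBall_zero_iff]; norm_num at hz₁a ⊢; linarith, by
      simp only [D, mem_closedBall_zero_iff]
      calc _ ≤ ‖c z₁'‖ + ‖a z₁' * s₁‖ := norm_add_le _ _
        _ ≤ ‖c z₁'‖ + ‖a z₁'‖ := by
          rw [norm_mul]; gcongr; exact mul_le_of_le_one_right (norm_nonneg _) hs₁
        _ ≤ 1 := gap₁ _ hz₁n hz₁a⟩
  -- hence the maximum is attained in the interior of a disc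
  have hmax : IsMaxOn (norm ∘ fun z => φ (z, s)) B z₂' := fun z hz => by
    have : ‖φ (z, s)‖ ≤ ‖φ (z₁, s₁)‖ := hmax₁ ⟨subset_closure hz, hsD⟩
    change ‖φ (z, s)‖ ≤ ‖φ (z₂', s)‖
    rw [hφs]
    linarith
  have hconst := Complex.norm_eqOn_closure_of_isPreconnected_of_isMaxOn
    (convex_ball _ _).isPreconnected Metric.isOpen_ball
    (f := fun z => φ (z, s)) (Differentiable.diffContOnCl (by fun_prop)) hz₂B hmax
  have hend : ‖φ (-3 / 2, s)‖ = ‖φ (z₂', s)‖ := hconst ((memB _).2 (by norm_num))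
  have := H (-3 / 2, c (-3 / 2) + a (-3 / 2) * s)
    (Or.inl ⟨(-3 / 2, s), ⟨⟨by norm_num, by norm_num⟩, hsD⟩, rfl⟩)
  have h3 : ‖φ (-3 / 2, s)‖ < 1 := this
  rw [hend, hφs] at h3
  linarith

section Position

/-- Arcs whose union is the projection of `leftPiece` and `rightPiece`, the left one being
rotated by a half turn. -/
def slitArcs : Set ℂ := {z | ‖z‖ = 1 ∧ 0.1 ≤ ‖z + 1‖} ∪ {z | ‖1 / 2 - z‖ = 1 ∧ 0.6 ≤ ‖z‖}

theorem slitArcs_subset_slitPlane : slitArcs ⊆ Complex.slitPlane := by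
  intro z hz
  rw [Complex.mem_slitPlane_iff]
  by_contra! h
  obtain ⟨x, hx⟩ : ∃ x : ℝ, z = x := ⟨z.re, Complex.ext rfl (by simp [h.2])⟩
  have hx0 : x ≤ 0 := by simpa [hx] using h.1
  rcases hz with ⟨h1, h2⟩ | ⟨h1, h2⟩
  · rw [hx, Complex.norm_real, Real.norm_of_nonpos hx0] at h1
    have : z + 1 = 0 := by
      rw [hx, show x = -1 by linarith]
      simp
    norm_num [this] at h2
  · have e : (1 / 2 - z : ℂ) = ((1 / 2 - x : ℝ) : ℂ) := by rw [hx]; push_cast; ring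
    rw [e, Complex.norm_real, Real.norm_of_nonneg (by linarith)] at h1
    rw [hx, Complex.norm_real, Real.norm_of_nonpos hx0] at h2
    norm_num at h2
    linarith

theorem isCompact_slitArcs : IsCompact slitArcs := by
  have hc (c : ℂ) : IsClosed {z : ℂ | ‖c - z‖ = 1} := isClosed_eq (by fun_prop) (by fun_prop)
  have hg (c : ℂ) (r : ℝ) : IsClosed {z : ℂ | r ≤ ‖z + c‖} :=
    isClosed_le (by fun_prop) (by fun_prop)
  refine Metric.isCompact_of_isClosed_isBounded (IsClosed.union ?_ ?_) ?_
  · simpa [ofPred_and] using (hc 0).inter (hg 1 0.1)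
  · simpa [ofPred_and] using (hc (1 / 2)).inter (hg 0 0.6)
  · refine isBounded_iff_forall_norm_le.2 ⟨2, ?_⟩
    rintro z (⟨h1, -⟩ | ⟨h1, -⟩)
    · linarith
    · have := norm_sub_le (1 / 2 : ℂ) (1 / 2 - z)
      rw [sub_sub_cancel, h1] at this
      norm_num at this
      linarith

/-- The points close to `slitArcs` in the logarithmic sense. -/
def slitArcsThickening (η : ℝ) : Set ℂ :=
  (fun q : ℂ × ℂ => q.1 * Complex.exp q.2) '' (slitArcs ×ˢ Metric.closedBall 0 η)

theorem isCompact_slitArcsThickening (η : ℝ) : IsCompact (slitArcsThickening η) :=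
  (isCompact_slitArcs.prod (isCompact_closedBall _ _)).image (by fun_prop)

theorem exists_slitArcsThickening_subset_slitPlane :
    ∃ η > 0, slitArcsThickening η ⊆ Complex.slitPlane := by
  have hW : IsOpen ((fun q : ℂ × ℂ => q.1 * Complex.exp q.2) ⁻¹' Complex.slitPlane) :=
    Complex.isOpen_slitPlane.preimage (by fun_prop)
  obtain ⟨u, v, -, hv, hu, h0, huv⟩ := generalized_tube_lemma isCompact_slitArcs
    (isCompact_singleton (x := (0 : ℂ))) hW (by
      rintro ⟨z, w⟩ ⟨hz, hw⟩
      have : w = 0 := hw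
      simpa [this] using slitArcs_subset_slitPlane hz)
  obtain ⟨η, hη, hηv⟩ := Metric.nhds_basis_closedBall.mem_iff.1 (hv.mem_nhds (h0 rfl))
  exact ⟨η, hη, image_subset_iff.2 ((prod_mono hu hηv).trans huv)⟩

/-- An automorphism of `{z ≠ 0} ⊆ ℂ²`, followed by the translation taking `(1, 0)` to the
origin. -/
noncomputable def straighten (N : ℕ) (τ μ ε : ℂ) (g : ℂ → ℂ) (p : ℂ × ℂ) : ℂ × ℂ :=
  let h := p.2 / p.1 ^ N
  let z := p.1 * Complex.exp (τ * h)
  (z * Complex.exp (-(μ * h + g z)) - 1, ε * (μ * h + g z))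

/-- The inverse of `straighten`. -/
noncomputable def unstraighten (N : ℕ) (τ μ ε : ℂ) (g : ℂ → ℂ) (p : ℂ × ℂ) : ℂ × ℂ :=
  let b := p.2 / ε
  let z := (1 + p.1) * Complex.exp b
  let h := (b - g z) / μ
  (z * Complex.exp (-(τ * h)), h * (z * Complex.exp (-(τ * h))) ^ N)

variable {N : ℕ} {τ μ ε : ℂ} {g : ℂ → ℂ}

theorem differentiable_unstraighten (hg : Differentiable ℂ g) :
    Differentiable ℂ (unstraighten N τ μ ε g) := by
  unfold unstraighten
  fun_prop

theorem differentiableOn_straighten (hg : Differentiable ℂ g) :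
    DifferentiableOn ℂ (straighten N τ μ ε g) {p | p.1 ≠ 0} := by
  intro p hp
  have hp' : p.1 ^ N ≠ 0 := pow_ne_zero _ hp
  refine DifferentiableAt.differentiableWithinAt ?_
  unfold straighten
  fun_prop (disch := assumption)

theorem unstraighten_fst_ne_zero {p : ℂ × ℂ} (hp : 1 + p.1 ≠ 0) :
    (unstraighten N τ μ ε g p).1 ≠ 0 :=
  mul_ne_zero (mul_ne_zero hp (Complex.exp_ne_zero _)) (Complex.exp_ne_zero _)

theorem straighten_unstraighten (hμ : μ ≠ 0) (hε : ε ≠ 0) {p : ℂ × ℂ} (hp : 1 + p.1 ≠ 0) :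
    straighten N τ μ ε g (unstraighten N τ μ ε g p) = p := by
  have h0 := unstraighten_fst_ne_zero (N := N) (τ := τ) (μ := μ) (ε := ε) (g := g) hp
  obtain ⟨u, v⟩ := p
  set b := v / ε with hb
  set z := (1 + u) * Complex.exp b with hz
  set h := (b - g z) / μ with hh
  set y := z * Complex.exp (-(τ * h)) with hy
  have e : unstraighten N τ μ ε g (u, v) = (y, h * y ^ N) := rfl
  rw [e] at h0 ⊢
  have e1 : h * y ^ N / y ^ N = h := mul_div_cancel_right₀ _ (pow_ne_zero _ h0)
  have e2 : y * Complex.exp (τ * h) = z := by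
    rw [hy, mul_assoc, ← Complex.exp_add, neg_add_cancel, Complex.exp_zero, mul_one]
  have e3 : μ * h + g z = b := by
    rw [hh, mul_div_cancel₀ _ hμ, sub_add_cancel]
  simp only [straighten, e1, e2, e3]
  rw [hz, mul_assoc, ← Complex.exp_add, add_neg_cancel, Complex.exp_zero, mul_one,
    add_sub_cancel_left, hb, mul_div_cancel₀ _ hε]

theorem unstraighten_straighten (hμ : μ ≠ 0) (hε : ε ≠ 0) {p : ℂ × ℂ} (hp : p.1 ≠ 0) :
    unstraighten N τ μ ε g (straighten N τ μ ε g p) = p := by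
  obtain ⟨x, w⟩ := p
  set h := w / x ^ N with hh
  set z := x * Complex.exp (τ * h) with hz
  have e : straighten N τ μ ε g (x, w) =
    (z * Complex.exp (-(μ * h + g z)) - 1, ε * (μ * h + g z)) := rfl
  have e1 : ε * (μ * h + g z) / ε = μ * h + g z := mul_div_cancel_left₀ _ hε
  have e2 : (1 + (z * Complex.exp (-(μ * h + g z)) - 1)) * Complex.exp (μ * h + g z) = z := by
    rw [add_sub_cancel, mul_assoc, ← Complex.exp_add, neg_add_cancel, Complex.exp_zero, mul_one]
  have e3 : (μ * h + g z - g z) / μ = h := by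
    rw [add_sub_cancel_right, mul_div_cancel_left₀ _ hμ]
  have e4 : z * Complex.exp (-(τ * h)) = x := by
    rw [hz, mul_assoc, ← Complex.exp_add, add_neg_cancel, Complex.exp_zero, mul_one]
  rw [e]
  simp only [unstraighten, e1, e2, e3, e4]
  rw [hh, div_mul_cancel₀ _ (pow_ne_zero _ hp)]

/-- A set whose points are, up to small logarithmic error, spun onto `slitArcs` can be moved into
any neighbourhood of the origin. -/
theorem exists_straighten_mem {V : Set (ℂ × ℂ)} (hV : V ∈ 𝓝 0) {K : Set (ℂ × ℂ)} {η B : ℝ}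
    (hη : slitArcsThickening η ⊆ Complex.slitPlane)
    (hK : ∀ p ∈ K, p.1 * Complex.exp (τ * (p.2 / p.1 ^ N)) ∈ slitArcsThickening η)
    (hB : ∀ p ∈ K, ‖p.2 / p.1 ^ N‖ ≤ B) :
    ∃ (μ ε : ℂ) (g : ℂ → ℂ), μ ≠ 0 ∧ ε ≠ 0 ∧ Differentiable ℂ g ∧
      ∀ p ∈ K, straighten N τ μ ε g p ∈ V := by
  have hcont : Tendsto (fun q : ℂ × ℂ => (Complex.exp q.1 - 1, q.2)) (𝓝 0) (𝓝 0) := by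
    have : Continuous (fun q : ℂ × ℂ => (Complex.exp q.1 - 1, q.2)) := by fun_prop
    simpa only [Prod.fst_zero, Prod.snd_zero, Complex.exp_zero, sub_self, Prod.mk_zero_zero]
      using this.tendsto 0
  obtain ⟨r, hr, hrV⟩ := Metric.mem_nhds_iff.1 (hcont hV)
  obtain ⟨P, hP⟩ := Complex.exists_polynomial_norm_sub_log_lt (isCompact_slitArcsThickening η) hη
    (half_pos hr)
  have hPd : Differentiable ℂ (fun z => P.eval z) := P.differentiable
  obtain ⟨D, hD⟩ := (isCompact_slitArcsThickening η).exists_bound_of_continuousOn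
    hPd.continuous.continuousOn
  set m : ℝ := r / 2 / (|B| + 1) with hm
  have hm0 : 0 < m := by positivity
  set e : ℝ := r / (r / 2 + |D| + 1) with he
  have he0 : 0 < e := by positivity
  refine ⟨m, e, fun z => P.eval z, by exact_mod_cast hm0.ne', by exact_mod_cast he0.ne', hPd,
    fun p hp => ?_⟩
  have hz := hK p hp
  have hh := hB p hp
  set h := p.2 / p.1 ^ N with hhdef
  set z := p.1 * Complex.exp (τ * h) with hzdef
  have h1 : ‖(m : ℂ) * h‖ < r / 2 := by
    rw [norm_mul, Complex.norm_real, Real.norm_of_nonneg hm0.le]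
    calc m * ‖h‖ < m * (|B| + 1) := by
          gcongr
          linarith [le_abs_self B]
      _ = r / 2 := by rw [hm]; field_simp
  have h2 := hP z hz
  have h3 : ‖(e : ℂ) * (m * h + P.eval z)‖ < r := by
    rw [norm_mul, Complex.norm_real, Real.norm_of_nonneg he0.le]
    calc e * ‖m * h + P.eval z‖ < e * (r / 2 + |D| + 1) := by
          gcongr
          linarith [norm_add_le ((m : ℂ) * h) (P.eval z), hD z hz, le_abs_self D]
      _ = r := by rw [he]; field_simp
  have h4 : ‖Complex.log z - P.eval z - m * h‖ < r := by
    rw [norm_sub_rev] at h2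
    linarith [norm_sub_le (Complex.log z - P.eval z) (m * h)]
  have h5 : straighten N τ m e (fun z => P.eval z) p =
      (Complex.exp (Complex.log z - P.eval z - m * h) - 1, (e : ℂ) * (m * h + P.eval z)) := by
    have hz0 : z ≠ 0 := Complex.slitPlane_ne_zero (hη hz)
    have : Complex.log z - P.eval z - m * h = Complex.log z + -(m * h + P.eval z) := by ring
    rw [this, Complex.exp_add, Complex.exp_log hz0]
    rfl
  rw [h5]
  exact hrV (show (_, _) ∈ Metric.ball (0 : ℂ × ℂ) r by
    rw [mem_ball_zero_iff, Prod.norm_def]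
    exact max_lt h4 h3)

end Position

section Parameters

theorem norm_sub_half_eq {z : ℂ} (hz : ‖z + 1 / 2‖ = 1) : ‖3 / 4 - z / 2‖ = ‖z‖ := by
  have h : ‖z + 1 / 2‖ ^ 2 = 1 := by rw [hz, one_pow]
  rw [← sq_eq_sq₀ (norm_nonneg _) (norm_nonneg _)]
  rw [← Complex.normSq_eq_norm_sq, Complex.normSq_apply] at h ⊢
  rw [← Complex.normSq_eq_norm_sq, Complex.normSq_apply]
  norm_num at h ⊢
  linarith

/-- Choice of the degree and of the sizes of the two families of discs. -/
theorem exists_degree {η : ℝ} (hη : 0 < η) : ∃ (N : ℕ) (M κ : ℝ), 0 < M ∧ 0 < κ ∧ κ ≤ 1 ∧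
    M * 0.6 ^ N = 1 / 2 ∧ Real.pi / M ≤ η ∧ Real.pi * κ ≤ η ∧ M + 1 ≤ κ * M * 1.2 ^ N := by
  have h1 : Tendsto (fun N : ℕ => (1 / 2 : ℝ) * (5 / 3) ^ N) atTop atTop :=
    (tendsto_pow_atTop_atTop_of_one_lt (by norm_num)).const_mul_atTop (by norm_num)
  have h2 : Tendsto (fun N : ℕ => Real.pi * (20 / 23) ^ N) atTop (𝓝 0) := by
    simpa using (tendsto_pow_atTop_nhds_zero_of_lt_one (r := (20 / 23 : ℝ)) (by norm_num)
      (by norm_num)).const_mul Real.pi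
  have h3 : Tendsto (fun N : ℕ => (24 / 23 : ℝ) ^ N) atTop atTop :=
    tendsto_pow_atTop_atTop_of_one_lt (by norm_num)
  obtain ⟨N, hN1, hN2, hN3⟩ := ((h1.eventually_ge_atTop (Real.pi / η)).and
    ((h2.eventually_le_const hη).and (h3.eventually_ge_atTop 3))).exists
  have hM : (1 : ℝ) ≤ (5 / 3) ^ N := one_le_pow₀ (by norm_num)
  refine ⟨N, 1 / 2 * (5 / 3) ^ N, (20 / 23) ^ N, by positivity, by positivity,
    pow_le_one₀ (by norm_num) (by norm_num), ?_, ?_, hN2, ?_⟩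
  · rw [mul_assoc, ← mul_pow]
    norm_num
  · rw [div_le_iff₀ (by positivity), mul_comm]
    exact (div_le_iff₀ hη).1 hN1
  · have : (20 / 23 : ℝ) ^ N * (1 / 2 * (5 / 3) ^ N) * 1.2 ^ N =
        1 / 2 * (5 / 3) ^ N * (24 / 23) ^ N := by
      have : (24 / 23 : ℝ) = 20 / 23 * 1.2 := by norm_num
      rw [this, mul_pow]
      ring
    rw [this]
    nlinarith

theorem isCompact_rightPiece : IsCompact rightPiece := by
  refine IsCompact.prod ?_ (isCompact_closedBall _ _)
  refine (isCompact_sphere (0 : ℂ) 1).of_isClosed_subset ?_ fun z hz => by simpa using hz.1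
  have h1 : IsClosed {z : ℂ | ‖z‖ = 1} := isClosed_eq (by fun_prop) (by fun_prop)
  have h2 : IsClosed {z : ℂ | 0.1 ≤ ‖z + 1‖} := isClosed_le (by fun_prop) (by fun_prop)
  exact h1.inter h2

theorem isCompact_leftPiece {c a : ℂ → ℂ} (hc : Continuous c) (ha : Continuous a) :
    IsCompact (leftPiece c a) := by
  refine IsCompact.image (IsCompact.prod ?_ (isCompact_closedBall _ _)) (by fun_prop)
  refine (isCompact_sphere (-1 / 2 : ℂ) 1).of_isClosed_subset ?_ fun z hz => by
    rw [mem_sphere_iff_norm, neg_div, sub_neg_eq_add]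
    exact hz.1
  have h1 : IsClosed {z : ℂ | ‖z + 1 / 2‖ = 1} := isClosed_eq (by fun_prop) (by fun_prop)
  have h2 : IsClosed {z : ℂ | 0.6 ≤ ‖z‖} := isClosed_le (by fun_prop) (by fun_prop)
  exact h1.inter h2

/-- There is a compact set, contained in a translate of `V` by an automorphism of `{z ≠ 0}`, whose
polynomial hull contains the origin. -/
theorem exists_straighten_hull {V : Set (ℂ × ℂ)} (hV : V ∈ 𝓝 0) :
    ∃ (N : ℕ) (τ μ ε : ℂ) (g : ℂ → ℂ) (K : Set (ℂ × ℂ)), μ ≠ 0 ∧ ε ≠ 0 ∧ Differentiable ℂ g ∧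
      IsCompact K ∧ (∀ p ∈ K, p.1 ≠ 0 ∧ straighten N τ μ ε g p ∈ V) ∧
      ∀ f : ℂ × ℂ → ℂ, Differentiable ℂ f → 1 ≤ ‖f (0, 0)‖ → ∃ p ∈ K, 1 ≤ ‖f p‖ := by
  obtain ⟨η, hη0, hη⟩ := exists_slitArcsThickening_subset_slitPlane
  obtain ⟨N, M, κ, hM, hκ, hκ1, hM6, hMη, hκη, hgap⟩ := exists_degree hη0
  set c : ℂ → ℂ := fun z => M * z ^ N with hcdef
  set a : ℂ → ℂ := fun z => κ * M * (3 / 4 - z / 2) ^ N with hadef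
  have hc : Differentiable ℂ c := by fun_prop
  have ha : Differentiable ℂ a := by fun_prop
  have hcn (z : ℂ) : ‖c z‖ = M * ‖z‖ ^ N := by
    rw [hcdef, norm_mul, norm_pow, Complex.norm_real, Real.norm_of_nonneg hM.le]
  have han (z : ℂ) : ‖a z‖ = κ * M * ‖3 / 4 - z / 2‖ ^ N := by
    rw [hadef, norm_mul, norm_mul, norm_pow, Complex.norm_real, Complex.norm_real,
      Real.norm_of_nonneg hM.le, Real.norm_of_nonneg hκ.le]
  have hspin : ∀ p ∈ leftPiece c a ∪ rightPiece, p.1 ≠ 0 ∧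
      p.1 * Complex.exp (Real.pi * Complex.I / M * (p.2 / p.1 ^ N)) ∈ slitArcsThickening η ∧
      ‖p.2 / p.1 ^ N‖ ≤ 2 * M + 1 := by
    rintro p (⟨⟨z, s⟩, ⟨⟨hz1, hz2⟩, hs⟩, rfl⟩ | ⟨⟨hz1, hz2⟩, hw⟩)
    · have hz0 : z ≠ 0 := by
        rintro rfl
        norm_num at hz2
      have hs1 : ‖s‖ ≤ 1 := mem_closedBall_zero_iff.1 hs
      set t := ((3 / 4 - z / 2) / z) ^ N * s with ht
      have ht1 : ‖t‖ ≤ 1 := by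
        rw [ht, norm_mul, norm_pow, norm_div, norm_sub_half_eq hz1,
          div_self (norm_ne_zero_iff.2 hz0), one_pow, one_mul]
        exact hs1
      have hh : (c z + a z * s) / z ^ N = M + κ * M * t := by
        have := pow_ne_zero N hz0
        rw [hcdef, hadef, ht, div_pow]
        field_simp
      dsimp only
      rw [hh]
      refine ⟨hz0, ⟨(-z, Real.pi * κ * Complex.I * t), ⟨Or.inr ⟨?_, ?_⟩, ?_⟩, ?_⟩, ?_⟩
      · rw [sub_neg_eq_add, add_comm]
        exact hz1
      · rw [norm_neg]
        exact hz2
      · rw [mem_closedBall_zero_iff, norm_mul, norm_mul, norm_mul, Complex.norm_I,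
          Complex.norm_real, Complex.norm_real, Real.norm_of_nonneg Real.pi_pos.le,
          Real.norm_of_nonneg hκ.le, mul_one]
        exact (mul_le_of_le_one_right (by positivity) ht1).trans hκη
      · have hM' : (M : ℂ) ≠ 0 := by exact_mod_cast hM.ne'
        have : Real.pi * Complex.I / M * (M + κ * M * t) =
            Real.pi * Complex.I + Real.pi * κ * Complex.I * t := by
          field_simp
        dsimp only
        rw [this, Complex.exp_add, Complex.exp_pi_mul_I]
        ring
      · have h1 : ‖(κ * M * t : ℂ)‖ ≤ M := by
          rw [norm_mul, norm_mul, Complex.norm_real, Complex.norm_real,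
            Real.norm_of_nonneg hM.le, Real.norm_of_nonneg hκ.le]
          calc κ * M * ‖t‖ ≤ 1 * M * 1 := by gcongr
            _ = M := by ring
        have h2 := norm_add_le (M : ℂ) (κ * M * t)
        rw [Complex.norm_real, Real.norm_of_nonneg hM.le] at h2
        linarith
    · have hw1 : ‖p.2‖ ≤ 1 := mem_closedBall_zero_iff.1 hw
      have hh : ‖p.2 / p.1 ^ N‖ ≤ 1 := by
        rw [norm_div, norm_pow, hz1, one_pow, div_one]
        exact hw1
      refine ⟨norm_ne_zero_iff.1 (by rw [hz1]; norm_num),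
        ⟨(p.1, Real.pi * Complex.I / M * (p.2 / p.1 ^ N)), ⟨Or.inl ⟨hz1, hz2⟩, ?_⟩, rfl⟩,
        by linarith⟩
      rw [mem_closedBall_zero_iff, norm_mul, norm_div, norm_mul, Complex.norm_I,
        Complex.norm_real, Complex.norm_real, Real.norm_of_nonneg Real.pi_pos.le,
        Real.norm_of_nonneg hM.le, mul_one]
      exact (mul_le_of_le_one_right (by positivity) hh).trans hMη
  obtain ⟨μ, ε, g, hμ, hε, hg, hKV⟩ := exists_straighten_mem hV hη
    (fun p hp => (hspin p hp).2.1) (fun p hp => (hspin p hp).2.2)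
  refine ⟨N, _, μ, ε, g, leftPiece c a ∪ rightPiece, hμ, hε, hg,
    (isCompact_leftPiece hc.continuous ha.continuous).union isCompact_rightPiece,
    fun p hp => ⟨(hspin p hp).1, hKV p hp⟩, fun f hf hf0 => ?_⟩
  refine exists_mem_pieces_one_le_norm hf hc ha (fun z hz1 hz2 => ?_) (fun z hz1 hz2 => ?_) hf0
  · rw [hcn, han, norm_sub_half_eq hz1]
    have h1 : M * ‖z‖ ^ N ≤ 1 / 2 := by
      rw [← hM6]
      gcongr
    have h2 : 0 ≤ M * ‖z‖ ^ N := by positivity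
    nlinarith
  · have h1 : 1.2 ≤ ‖3 / 4 - z / 2‖ := by
      have e : (5 / 4 : ℂ) = (3 / 4 - z / 2) + (1 / 2) * (z + 1) := by ring
      have := norm_add_le (3 / 4 - z / 2) ((1 / 2) * (z + 1))
      rw [← e, norm_mul] at this
      norm_num at this hz2 ⊢
      linarith
    rw [hcn, han, hz1, one_pow, mul_one]
    exact hgap.trans (by gcongr)

end Parameters

/-- A Fatou–Bieberbach domain in `{z ≠ 0} ⊆ ℂ²` which contains a compact set whose polynomial hull
meets the line `z = 0`. -/
theorem exists_fatouBieberbach_domain_with_hull :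
    ∃ (Ω K : Set (ℂ × ℂ)) (F G : ℂ × ℂ → ℂ × ℂ) (H : ℕ → ℂ × ℂ → ℂ × ℂ), IsOpen Ω ∧
      (∀ p ∈ Ω, p.1 ≠ 0) ∧ Differentiable ℂ F ∧ DifferentiableOn ℂ G Ω ∧
      (∀ y, F y ∈ Ω ∧ G (F y) = y) ∧ (∀ x ∈ Ω, F (G x) = x) ∧
      (∀ n, DifferentiableOn ℂ (H n) {p | p.1 ≠ 0}) ∧ TendstoLocallyUniformlyOn H G atTop Ω ∧
      IsCompact K ∧ K ⊆ Ω ∧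
      ∀ f : ℂ × ℂ → ℂ, Differentiable ℂ f → 1 ≤ ‖f (0, 0)‖ → ∃ p ∈ K, 1 ≤ ‖f p‖ := by
  obtain ⟨V, ψ, χ, H, hVo, h0V, hV, hψ, hχ, hψχ, hχψ, hH, hlim⟩ := exists_fatouBieberbach_domain
  obtain ⟨N, τ, μ, ε, g, K, hμ, hε, hg, hK, hKV, hhull⟩ :=
    exists_straighten_hull (hVo.mem_nhds h0V)
  set S := straighten N τ μ ε g
  have hS : DifferentiableOn ℂ S {p | p.1 ≠ 0} := differentiableOn_straighten hg
  have hU : IsOpen {p : ℂ × ℂ | p.1 ≠ 0} := isOpen_ne_fun continuous_fst continuous_const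
  have hsub : {p | p.1 ≠ 0} ∩ S ⁻¹' V ⊆ {p : ℂ × ℂ | p.1 ≠ 0} := inter_subset_left
  have hmaps : MapsTo S ({p | p.1 ≠ 0} ∩ S ⁻¹' V) V := fun p hp => hp.2
  refine ⟨{p | p.1 ≠ 0} ∩ S ⁻¹' V, K, unstraighten N τ μ ε g ∘ χ, ψ ∘ S, fun n => H n ∘ S,
    hS.continuousOn.isOpen_inter_preimage hU hVo, fun p hp => hp.1,
    (differentiable_unstraighten hg).comp hχ, hψ.comp (hS.mono hsub) hmaps, fun y => ?_,
    fun p hp => ?_, fun n => (hH n).comp_differentiableOn hS,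
    hlim.comp S hmaps (hS.continuousOn.mono hsub), hK, hKV, hhull⟩
  · have h1 := hV _ (hψχ y).1
    have h2 : S (unstraighten N τ μ ε g (χ y)) = χ y := straighten_unstraighten hμ hε h1
    refine ⟨⟨unstraighten_fst_ne_zero h1, ?_⟩, ?_⟩
    · rw [mem_preimage, Function.comp_apply, h2]
      exact (hψχ y).1
    · rw [Function.comp_apply, Function.comp_apply, h2]
      exact (hψχ y).2
  · rw [Function.comp_apply, Function.comp_apply, hχψ _ hp.2]
    exact unstraighten_straighten hμ hε hp.1

section Stabilization

variable {ι : Type*}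

/-- The coordinates of `x` at `i` and `j`. -/
def coordPair (i j : ι) (x : ι → ℂ) : ℂ × ℂ := (x i, x j)

theorem differentiable_coordPair [Fintype ι] (i j : ι) : Differentiable ℂ (coordPair i j) :=
  (differentiable_apply i).prodMk (differentiable_apply j)

variable [DecidableEq ι]

/-- Overwrite the coordinates of `x` at `i` and `j` by `p`. -/
def updatePair (i j : ι) (x : ι → ℂ) (p : ℂ × ℂ) : ι → ℂ :=
  Function.update (Function.update x j p.2) i p.1

/-- The map of `ι → ℂ` acting by `f` on the coordinates `i` and `j`, and trivially on the
others. -/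
def liftPair (i j : ι) (f : ℂ × ℂ → ℂ × ℂ) (x : ι → ℂ) : ι → ℂ :=
  updatePair i j x (f (coordPair i j x))

theorem updatePair_apply (i j : ι) (x : ι → ℂ) (p : ℂ × ℂ) (k : ι) :
    updatePair i j x p k = if k = i then p.1 else if k = j then p.2 else x k := by
  simp only [updatePair, Function.update_apply]

theorem coordPair_updatePair {i j : ι} (hij : i ≠ j) (x : ι → ℂ) (p : ℂ × ℂ) :
    coordPair i j (updatePair i j x p) = p := by
  simp [coordPair, updatePair_apply, hij.symm]

theorem coordPair_liftPair {i j : ι} (hij : i ≠ j) (f : ℂ × ℂ → ℂ × ℂ) (x : ι → ℂ) :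
    coordPair i j (liftPair i j f x) = f (coordPair i j x) :=
  coordPair_updatePair hij _ _

theorem liftPair_liftPair {i j : ι} (hij : i ≠ j) (f g : ℂ × ℂ → ℂ × ℂ) (x : ι → ℂ) :
    liftPair i j f (liftPair i j g x) = liftPair i j (f ∘ g) x := by
  ext k
  rw [liftPair, coordPair_liftPair hij, liftPair, liftPair, updatePair_apply, updatePair_apply,
    updatePair_apply]
  split_ifs <;> rfl

theorem liftPair_eq_self {i j : ι} {f : ℂ × ℂ → ℂ × ℂ} {x : ι → ℂ}
    (h : f (coordPair i j x) = coordPair i j x) : liftPair i j f x = x := by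
  ext k
  rw [liftPair, updatePair_apply, h]
  split_ifs with h1 h2
  · rw [h1, coordPair]
  · rw [h2, coordPair]
  · rfl

theorem differentiable_updatePair [Finite ι] (i j : ι) (x : ι → ℂ) :
    Differentiable ℂ (updatePair i j x) := by
  have := Fintype.ofFinite ι
  refine differentiable_pi.2 fun k => ?_
  simp only [updatePair_apply]
  split_ifs <;> fun_prop

theorem DifferentiableOn.liftPair [Fintype ι] {i j : ι} {f : ℂ × ℂ → ℂ × ℂ} {s : Set (ℂ × ℂ)}
    (hf : DifferentiableOn ℂ f s) : DifferentiableOn ℂ (liftPair i j f) (coordPair i j ⁻¹' s) := by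
  have hc : DifferentiableOn ℂ (fun x => f (coordPair i j x)) (coordPair i j ⁻¹' s) :=
    hf.comp (differentiable_coordPair i j).differentiableOn fun _ hx => hx
  refine differentiableOn_pi.2 fun k => ?_
  simp only [_root_.liftPair, updatePair_apply]
  split_ifs
  · exact hc.fst
  · exact hc.snd
  · exact (differentiable_apply k).differentiableOn

theorem norm_liftPair_sub_liftPair_le [Fintype ι] (i j : ι) (f g : ℂ × ℂ → ℂ × ℂ) (x : ι → ℂ) :
    ‖liftPair i j f x - liftPair i j g x‖ ≤ ‖f (coordPair i j x) - g (coordPair i j x)‖ := by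
  refine (pi_norm_le_iff_of_nonneg (norm_nonneg _)).2 fun k => ?_
  rw [Pi.sub_apply, liftPair, liftPair, updatePair_apply, updatePair_apply]
  split_ifs
  · exact norm_fst_le (f (coordPair i j x) - g (coordPair i j x))
  · exact norm_snd_le (f (coordPair i j x) - g (coordPair i j x))
  · rw [sub_self, norm_zero]
    exact norm_nonneg _

theorem TendstoLocallyUniformlyOn.liftPair [Fintype ι] {i j : ι} {H : ℕ → ℂ × ℂ → ℂ × ℂ}
    {G : ℂ × ℂ → ℂ × ℂ} {s : Set (ℂ × ℂ)} (h : TendstoLocallyUniformlyOn H G atTop s) :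
    TendstoLocallyUniformlyOn (fun n => liftPair i j (H n)) (liftPair i j G) atTop
      (coordPair i j ⁻¹' s) := by
  have hc := h.comp (coordPair i j) (fun _ hx => hx : MapsTo _ (coordPair i j ⁻¹' s) s)
    (differentiable_coordPair i j).continuous.continuousOn
  rw [Metric.tendstoLocallyUniformlyOn_iff] at hc ⊢
  intro ε hε x hx
  obtain ⟨t, ht, hn⟩ := hc ε hε x hx
  refine ⟨t, ht, hn.mono fun n hn y hy => ?_⟩
  rw [dist_eq_norm]
  refine (norm_liftPair_sub_liftPair_le i j G (H n) y).trans_lt ?_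
  rw [← dist_eq_norm]
  exact hn y hy

end Stabilization

/-- If the inverse of a Fatou–Bieberbach map onto `Ω` is a locally uniform limit of maps that are
holomorphic on `U ⊇ Ω`, then `Ω` is Runge in `U`. -/
theorem rungeIn_of_tendstoLocallyUniformlyOn {n : ℕ} {Ω U : Set (Fin n → ℂ)}
    {F G : (Fin n → ℂ) → Fin n → ℂ} {H : ℕ → (Fin n → ℂ) → Fin n → ℂ}
    (hF : Differentiable ℂ F) (hFΩ : ∀ x, F x ∈ Ω) (hG : ContinuousOn G Ω)
    (hFG : ∀ x ∈ Ω, F (G x) = x) (hH : ∀ k, DifferentiableOn ℂ (H k) U)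
    (hHG : TendstoLocallyUniformlyOn H G atTop Ω) (hΩ : IsOpen Ω) : RungeIn n Ω U := by
  intro f hf K hKΩ hK δ hδ
  have he : Differentiable ℂ fun x => f (F x) := fun x =>
    ((hf _ (hFΩ x)).differentiableAt (hΩ.mem_nhds (hFΩ x))).comp x (hF x)
  have hGK : IsCompact (G '' K) := hK.image_of_continuousOn (hG.mono hKΩ)
  have huc : UniformContinuousOn (fun x => f (F x)) (Metric.cthickening 1 (G '' K)) :=
    hGK.cthickening.uniformContinuousOn_of_continuous he.continuous.continuousOn
  obtain ⟨η, hη, hclose⟩ := Metric.uniformContinuousOn_iff.1 huc δ hδ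
  have hunif := (tendstoLocallyUniformlyOn_iff_tendstoUniformlyOn_of_compact hK).1
    (hHG.mono hKΩ)
  obtain ⟨k, hk⟩ := (Metric.tendstoUniformlyOn_iff.1 hunif (min η 1)
    (lt_min hη one_pos)).exists
  refine ⟨fun x => f (F (H k x)), he.comp_differentiableOn (hH k), fun z hz => ?_⟩
  have hzk := hk z hz
  have hGz : G z ∈ G '' K := mem_image_of_mem G hz
  have := hclose (G z) (Metric.self_subset_cthickening _ hGz) (H k z)
    (Metric.mem_cthickening_of_dist_le _ (G z) _ _ hGz
      (by rw [dist_comm]; exact (hzk.trans_le (min_le_right _ _)).le))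
    (hzk.trans_le (min_le_left _ _))
  rwa [dist_eq_norm, hFG z (hKΩ hz)] at this

/-- A domain in the complement of `{x i = 0}` is not Runge in `ℂⁿ` as soon as it contains a compact
subset of a coordinate plane whose polynomial hull contains the origin. -/
theorem not_rungeIn_univ {n : ℕ} {i j : Fin n} (hij : i ≠ j) {Ω : Set (Fin n → ℂ)}
    {K : Set (ℂ × ℂ)} (hΩ : ∀ x ∈ Ω, x i ≠ 0) (hK : IsCompact K)
    (hKΩ : updatePair i j 0 '' K ⊆ Ω)
    (hull : ∀ f : ℂ × ℂ → ℂ, Differentiable ℂ f → 1 ≤ ‖f (0, 0)‖ → ∃ p ∈ K, 1 ≤ ‖f p‖) :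
    ¬ RungeIn n Ω univ := by
  intro hR
  obtain ⟨B, hB0, hB⟩ := hK.isBounded.exists_pos_norm_le
  have hdiff : DifferentiableOn ℂ (fun x : Fin n → ℂ => (x i)⁻¹) Ω :=
    (differentiable_apply i).differentiableOn.inv hΩ
  obtain ⟨g, hg, hgK⟩ := hR _ hdiff (updatePair i j 0 '' K) hKΩ
    (hK.image (differentiable_updatePair i j 0).continuous) B⁻¹ (inv_pos.2 hB0)
  have hg' : Differentiable ℂ fun p => g (updatePair i j 0 p) :=
    (differentiableOn_univ.1 hg).comp (differentiable_updatePair i j 0)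
  obtain ⟨p, hp, h1⟩ := hull (fun p => 1 - p.1 * g (updatePair i j 0 p))
    ((differentiable_const _).sub (differentiable_fst.mul hg')) (by simp)
  have hpi : updatePair i j 0 p i = p.1 := congrArg Prod.fst (coordPair_updatePair hij 0 p)
  have hp0 : p.1 ≠ 0 := hpi ▸ hΩ _ (hKΩ (mem_image_of_mem _ hp))
  have hlt := hgK _ (mem_image_of_mem _ hp)
  rw [hpi] at hlt
  refine h1.not_gt ?_
  calc ‖1 - p.1 * g (updatePair i j 0 p)‖
      = ‖p.1‖ * ‖p.1⁻¹ - g (updatePair i j 0 p)‖ := by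
        rw [← norm_mul, mul_sub, mul_inv_cancel₀ hp0]
    _ < ‖p.1‖ * B⁻¹ := mul_lt_mul_of_pos_left hlt (norm_pos_iff.2 hp0)
    _ ≤ B * B⁻¹ := by
        gcongr
        exact (norm_fst_le p).trans (hB p hp)
    _ = 1 := mul_inv_cancel₀ (ne_of_gt hB0)

/-- For every `n ≥ 2` there exist an open set `Ω ⊆ {z ∈ ℂⁿ : z₁ ≠ 0}` and a holomorphic
bijection `F : ℂⁿ → Ω` whose inverse `G : Ω → ℂⁿ` is holomorphic, such that `Ω` is Runge
in `{z₁ ≠ 0}` but not Runge in `ℂⁿ`: a non-Runge Fatou–Bieberbach domain avoiding the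
hyperplane `{z₁ = 0}` and Runge in its complement. -/
theorem stmt_17 (n : ℕ) (hn : 2 ≤ n) :
    ∃ (Ω : Set (Fin n → ℂ)) (Fmap Gmap : (Fin n → ℂ) → (Fin n → ℂ)),
      IsOpen Ω ∧
      Ω ⊆ {z | z ⟨0, by omega⟩ ≠ 0} ∧
      Differentiable ℂ Fmap ∧
      Function.Injective Fmap ∧
      Set.range Fmap = Ω ∧
      DifferentiableOn ℂ Gmap Ω ∧
      (∀ z, Gmap (Fmap z) = z) ∧
      (∀ w ∈ Ω, Fmap (Gmap w) = w) ∧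
      RungeIn n Ω {z | z ⟨0, by omega⟩ ≠ 0} ∧
      ¬ RungeIn n Ω Set.univ := by
  obtain ⟨Ω, K, F, G, H, hΩ, hΩ0, hF, hG, hFG, hGF, hH, hHG, hK, hKΩ, hull⟩ :=
    exists_fatouBieberbach_domain_with_hull
  set i : Fin n := ⟨0, by omega⟩
  obtain ⟨j, hij⟩ : ∃ j : Fin n, i ≠ j := ⟨⟨1, by omega⟩, by simp [i]⟩
  have hF' : Differentiable ℂ (liftPair i j F) :=
    differentiableOn_univ.1 (hF.differentiableOn (s := univ)).liftPair
  have hG' := hG.liftPair (i := i) (j := j)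
  have hΩ' : IsOpen (coordPair i j ⁻¹' Ω) :=
    hΩ.preimage (differentiable_coordPair i j).continuous
  have hmem (x) : liftPair i j F x ∈ coordPair i j ⁻¹' Ω := by
    rw [mem_preimage, coordPair_liftPair hij]
    exact (hFG _).1
  have hFG' (x) : liftPair i j G (liftPair i j F x) = x :=
    (liftPair_liftPair hij G F x).trans (liftPair_eq_self (hFG _).2)
  have hGF' (x) (hx : x ∈ coordPair i j ⁻¹' Ω) : liftPair i j F (liftPair i j G x) = x :=
    (liftPair_liftPair hij F G x).trans (liftPair_eq_self (hGF _ hx))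
  refine ⟨coordPair i j ⁻¹' Ω, liftPair i j F, liftPair i j G, hΩ', fun x hx => hΩ0 _ hx, hF',
    Function.LeftInverse.injective hFG', (range_subset_iff.2 hmem).antisymm fun x hx =>
      ⟨_, hGF' x hx⟩, hG', hFG', hGF',
    rungeIn_of_tendstoLocallyUniformlyOn hF' hmem hG'.continuousOn hGF'
      (fun k => (hH k).liftPair) hHG.liftPair hΩ',
    not_rungeIn_univ hij (fun x hx => hΩ0 _ hx) hK ?_ hull⟩
  rintro _ ⟨p, hp, rfl⟩
  rw [mem_preimage, coordPair_updatePair hij]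
  exact hKΩ hp
end
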